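/- arXiv:2412.20594 — 3 statements merged into one kernel-verified Lean document; each statement's English description precedes it below -/
import Mathlib

section
/- Let K ⊂ ℝ^d be a nonempty compact set with lower dimension β. Then there exists a weak tangent F ∈ Tan(K) with finite β-dimensional Hausdorff measure: H^β(F) < ∞. -/
open Metric MeasureTheory
open scoped ENNReal

/-- The covering number `N_r(F)`. -/
noncomputable def coverNum {X : Type*} [MetricSpace X] (r : ℝ) (F : Set X) : ℕ∞ :=
  sInf ((fun S : Finset X => (S.card : ℕ∞)) ''
    {S : Finset X | ↑S ⊆ F ∧ F ⊆ ⋃ x ∈ S, closedBall x r})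

/-- The lower dimension of a set. -/
noncomputable def lowerDim {X : Type*} [MetricSpace X] (K : Set X) : ℝ :=
  sSup {α : ℝ | 0 < α ∧ ∃ C : ℝ, 0 < C ∧ ∀ r R : ℝ, 0 < r → r ≤ R → R < 1 → ∀ x ∈ K,
    ENNReal.ofReal (C * (R / r) ^ α) ≤ (coverNum r (closedBall x R ∩ K) : ℝ≥0∞)}

/-- The miniset `λ(K - x) ∩ B(0,1)`. -/
def miniset {d : ℕ} (K : Set (EuclideanSpace ℝ (Fin d))) (x : EuclideanSpace ℝ (Fin d))
    (lam : ℝ) : Set (EuclideanSpace ℝ (Fin d)) :=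
  (fun y => lam • (y - x)) '' K ∩ closedBall 0 1

/-- A weak tangent of `K`: a Hausdorff-metric limit of minisets `λₙ(K - xₙ) ∩ B(0,1)`
with `xₙ ∈ K`, `λₙ ≥ 1` and `λₙ → ∞`. -/
def IsWeakTangent {d : ℕ} (K E : Set (EuclideanSpace ℝ (Fin d))) : Prop :=
  E.Nonempty ∧ IsCompact E ∧ ∃ (x : ℕ → EuclideanSpace ℝ (Fin d)) (lam : ℕ → ℝ),
    (∀ n, x n ∈ K) ∧ (∀ n, 1 ≤ lam n) ∧ Filter.Tendsto lam Filter.atTop Filter.atTop ∧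
    (∀ n, (miniset K (x n) (lam n)).Nonempty) ∧
    Filter.Tendsto (fun n => hausdorffDist (miniset K (x n) (lam n)) E)
      Filter.atTop (nhds 0)

/-- `s`-separated finsets. -/
def SepBy {X : Type*} [MetricSpace X] (s : ℝ) (T : Finset X) : Prop :=
  ∀ a ∈ T, ∀ b ∈ T, a ≠ b → s < dist a b

lemma sep_card_le {X : Type*} [MetricSpace X] {r : ℝ} {A : Set X} {S T : Finset X}
    (hS : A ⊆ ⋃ x ∈ S, closedBall x r) (hT : (T : Set X) ⊆ A) (hsep : SepBy (2 * r) T) :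
    T.card ≤ S.card := by
  have h : ∀ t : X, ∃ y : X, t ∈ T → y ∈ S ∧ dist t y ≤ r := by
    intro t
    by_cases ht : t ∈ T
    · have := hS (hT ht)
      simp only [Set.mem_iUnion, mem_closedBall, exists_prop] at this
      obtain ⟨y, hy⟩ := this
      exact ⟨y, fun _ => hy⟩
    · exact ⟨t, fun h => absurd h ht⟩
  choose f hf using h
  refine Finset.card_le_card_of_injOn f (fun t ht => (hf t ht).1) ?_
  intro a ha b hb hab
  by_contra hne
  have h1 := hsep a ha b hb hne
  have h2 := (hf a ha).2
  have h3 := (hf b hb).2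
  rw [← hab] at h3
  have := dist_triangle_right a b (f a)
  linarith

lemma exists_sep_cover {X : Type*} [MetricSpace X] {s : ℝ} (hs : 0 ≤ s) {A : Set X} {M : ℕ}
    (hM : ∀ T : Finset X, (T : Set X) ⊆ A → SepBy s T → T.card ≤ M) :
    ∃ S : Finset X, (S : Set X) ⊆ A ∧ SepBy s S ∧ A ⊆ ⋃ x ∈ S, closedBall x s := by
  classical
  let W : Set ℕ := {n | ∃ T : Finset X, (T : Set X) ⊆ A ∧ SepBy s T ∧ T.card = n}
  have hne : W.Nonempty := ⟨0, ∅, by simp, by simp [SepBy], rfl⟩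
  have hbd : BddAbove W := ⟨M, by rintro n ⟨T, h1, h2, rfl⟩; exact hM T h1 h2⟩
  obtain ⟨T, h1, h2, h3⟩ := Nat.sSup_mem hne hbd
  refine ⟨T, h1, h2, ?_⟩
  intro a ha
  by_contra hcon
  simp only [Set.mem_iUnion, mem_closedBall, exists_prop, not_exists, not_and, not_le] at hcon
  have haT : a ∉ T := fun h => by
    have := hcon a h
    simp at this
    linarith
  have : (insert a T).card ∈ W := by
    refine ⟨insert a T, ?_, ?_, rfl⟩
    · rw [Finset.coe_insert]
      exact Set.insert_subset ha h1
    · intro x hx y hy hxy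
      rcases Finset.mem_insert.1 hx with rfl | hx'
      · rcases Finset.mem_insert.1 hy with rfl | hy
        · exact absurd rfl hxy
        · exact hcon y hy
      · rcases Finset.mem_insert.1 hy with h | hy
        · rw [dist_comm, h]; exact hcon x hx'
        · exact h2 x hx' y hy hxy
  have := le_csSup hbd this
  rw [Finset.card_insert_of_notMem haT] at this
  omega

lemma exists_doubling (d : ℕ) : ∃ N : ℕ, 0 < N ∧ ∀ (x : EuclideanSpace ℝ (Fin d)) (R : ℝ), 0 < R →
    ∀ k : ℕ, ∃ S : Finset (EuclideanSpace ℝ (Fin d)), S.card ≤ N ^ k ∧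
      closedBall x R ⊆ ⋃ y ∈ S, closedBall y (R / 2 ^ k) := by
  classical
  obtain ⟨S0, -, hS0⟩ := (isCompact_closedBall (0 : EuclideanSpace ℝ (Fin d)) 1).elim_nhds_subcover
    (fun y => closedBall y (1 / 2)) (fun y _ => closedBall_mem_nhds y (by norm_num))
  refine ⟨S0.card + 1, by omega, ?_⟩
  intro x R hR k
  induction k with
  | zero => exact ⟨{x}, by simp, by simp⟩
  | succ k ih =>
    obtain ⟨S, hc, hS⟩ := ih
    set ρ : ℝ := R / 2 ^ k with hρ
    have hρ0 : 0 < ρ := by positivity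
    refine ⟨S.biUnion (fun y => S0.image (fun z => y + ρ • z)), ?_, ?_⟩
    · refine Finset.card_biUnion_le.trans ?_
      calc _ ≤ ∑ y ∈ S, (S0.card + 1) :=
            Finset.sum_le_sum (fun y _ => Finset.card_image_le.trans (by omega))
        _ = S.card * (S0.card + 1) := by simp
        _ ≤ _ := by rw [pow_succ]; gcongr
    · intro p hp
      have := hS hp
      simp only [Set.mem_iUnion, mem_closedBall, exists_prop] at this
      obtain ⟨y, hy, hpy⟩ := this
      have h1 : ρ⁻¹ • (p - y) ∈ closedBall (0 : EuclideanSpace ℝ (Fin d)) 1 := by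
        rw [mem_closedBall, dist_zero_right, norm_smul, norm_inv, Real.norm_of_nonneg hρ0.le,
          ← dist_eq_norm, inv_mul_le_iff₀ hρ0]
        simpa using hpy
      have h2 := hS0 h1
      simp only [Set.mem_iUnion, mem_closedBall, exists_prop] at h2
      obtain ⟨z, hz, hd⟩ := h2
      simp only [Set.mem_iUnion, mem_closedBall, exists_prop]
      refine ⟨y + ρ • z, ?_, ?_⟩
      · rw [Finset.mem_biUnion]
        exact ⟨y, hy, Finset.mem_image.2 ⟨z, hz, rfl⟩⟩
      · have h3 : p - (y + ρ • z) = ρ • (ρ⁻¹ • (p - y) - z) := by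
          rw [smul_sub, smul_smul, mul_inv_cancel₀ hρ0.ne', one_smul]; abel
        rw [dist_eq_norm, h3, norm_smul, Real.norm_of_nonneg hρ0.le, ← dist_eq_norm]
        calc ρ * _ ≤ ρ * (1 / 2) := by gcongr
          _ = R / 2 ^ (k + 1) := by rw [hρ, pow_succ]; field_simp

lemma lowerDim_bdd {d : ℕ} (K : Set (EuclideanSpace ℝ (Fin d))) (hne : K.Nonempty) :
    BddAbove {α : ℝ | 0 < α ∧ ∃ C : ℝ, 0 < C ∧ ∀ r R : ℝ, 0 < r → r ≤ R → R < 1 → ∀ x ∈ K,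
    ENNReal.ofReal (C * (R / r) ^ α) ≤ (coverNum r (closedBall x R ∩ K) : ℝ≥0∞)} := by
  obtain ⟨N, hN, hcov⟩ := exists_doubling d
  obtain ⟨x, hx⟩ := hne
  refine ⟨N, ?_⟩
  rintro α ⟨hα, C, hC, h⟩
  by_contra! hlt
  have hNα : (N : ℝ) < 2 ^ α := by
    calc (N : ℝ) < 2 ^ N := by exact_mod_cast Nat.lt_two_pow_self
      _ = (2 : ℝ) ^ (N : ℝ) := by rw [Real.rpow_natCast]
      _ ≤ 2 ^ α := Real.rpow_le_rpow_of_exponent_le (by norm_num) hlt.le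
  have hN' : (0 : ℝ) < N := by exact_mod_cast hN
  have key : ∀ k : ℕ, C * (2 ^ α) ^ k ≤ (N : ℝ) ^ (k + 1) := by
    intro k
    obtain ⟨S, hSc, hS⟩ := hcov x (1 / 2) (by norm_num) (k + 1)
    have hp : (0 : ℝ) < 2 ^ k := by positivity
    have hr : (2 : ℝ) * (1 / 2 / 2 ^ (k + 1)) = (1 / 2) / 2 ^ k := by
      rw [pow_succ]; field_simp
    obtain ⟨T, hT, hsep, hTc⟩ := exists_sep_cover (s := 2 * (1 / 2 / 2 ^ (k + 1)))
      (A := closedBall x (1 / 2) ∩ K) (M := S.card) (by positivity)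
      (fun T hT hs => sep_card_le hS (hT.trans Set.inter_subset_left) hs)
    have hTS : T.card ≤ S.card := sep_card_le hS (hT.trans Set.inter_subset_left) hsep
    have h1 := h (2 * (1 / 2 / 2 ^ (k + 1))) (1 / 2) (by positivity)
      (by rw [hr]; exact div_le_self (by norm_num) (one_le_pow₀ (by norm_num))) (by norm_num) x hx
    have h2 : coverNum (2 * (1 / 2 / 2 ^ (k + 1))) (closedBall x (1 / 2) ∩ K) ≤ (T.card : ℕ∞) :=
      sInf_le ⟨T, ⟨hT, hTc⟩, rfl⟩
    have h3 : ((coverNum (2 * (1 / 2 / 2 ^ (k + 1))) (closedBall x (1 / 2) ∩ K) : ℕ∞) : ℝ≥0∞)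
      ≤ ((N ^ (k + 1) : ℕ) : ℝ≥0∞) := by
      have h4 := h2.trans (Nat.cast_le.2 (hTS.trans hSc))
      exact_mod_cast (ENat.toENNReal_le.2 h4)
    have h5 := h1.trans h3
    rw [hr, ← ENNReal.ofReal_natCast, ENNReal.ofReal_le_ofReal_iff (by positivity)] at h5
    have h6 : (1 / 2 : ℝ) / (1 / 2 / 2 ^ k) = 2 ^ k := by field_simp
    rw [h6] at h5
    have h7 : ((2 : ℝ) ^ k) ^ α = (2 ^ α) ^ k := by
      rw [← Real.rpow_natCast, ← Real.rpow_natCast, ← Real.rpow_mul (by norm_num),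
        ← Real.rpow_mul (by norm_num), mul_comm]
    rw [h7] at h5
    exact_mod_cast h5
  have hq : 1 < (2 : ℝ) ^ α / N := by rwa [one_lt_div hN']
  obtain ⟨k, hk⟩ := pow_unbounded_of_one_lt (N / C : ℝ) hq
  have := key k
  rw [div_pow, div_lt_div_iff₀ hC (by positivity), ← pow_succ'] at hk
  linarith

lemma small_start {d : ℕ} (K : Set (EuclideanSpace ℝ (Fin d))) (hne : K.Nonempty)
    {α : ℝ} (hα : 0 < α) (hlt : lowerDim K < α) {C : ℝ} (hC : 0 < C) :
    ∃ r R : ℝ, 0 < r ∧ r ≤ R ∧ R < 1 ∧ ∃ x ∈ K, ∀ T : Finset (EuclideanSpace ℝ (Fin d)),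
      (T : Set _) ⊆ closedBall x R ∩ K → SepBy (2 * r) T → (T.card : ℝ) ≤ C * (R / r) ^ α := by
  have h := notMem_of_csSup_lt hlt (lowerDim_bdd K hne)
  simp only [Set.mem_setOf_eq, not_and, not_exists] at h
  have h := h hα C hC
  push Not at h
  obtain ⟨r, R, hr, hrR, hR, x, hx, hlt⟩ := h
  refine ⟨r, R, hr, hrR, hR, x, hx, ?_⟩
  intro T hT hsep
  have hRr : 0 < R / r := div_pos (by linarith) hr
  have hle : ((T.card : ℕ∞)) ≤ coverNum r (closedBall x R ∩ K) := by
    refine le_sInf ?_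
    rintro _ ⟨S, ⟨_, hS⟩, rfl⟩
    exact Nat.cast_le.2 (sep_card_le hS hT hsep)
  have h2 : ((T.card : ℕ) : ℝ≥0∞) < ENNReal.ofReal (C * (R / r) ^ α) :=
    lt_of_le_of_lt (by exact_mod_cast (ENat.toENNReal_le.2 hle)) hlt
  rw [← ENNReal.ofReal_natCast] at h2
  exact ((ENNReal.ofReal_lt_ofReal_iff (by positivity)).1 h2).le

lemma key_scale {d : ℕ} (K : Set (EuclideanSpace ℝ (Fin d))) (hne : K.Nonempty)
    {α : ℝ} (hα : 0 < α) (hlt : lowerDim K < α) {δ ε : ℝ} (hδ : 0 < δ) (hδ1 : δ ≤ 1)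
    (hε : 0 < ε) (hε1 : ε ≤ 1) :
    ∃ x ∈ K, ∃ s R : ℝ, 0 < s ∧ s ≤ ε * R ∧ R ≤ δ ∧ ∀ r, s ≤ r → r ≤ R / 2 →
      ∀ Z : Finset (EuclideanSpace ℝ (Fin d)), (Z : Set _) ⊆ closedBall x (R / 2) ∩ K →
        SepBy (3 * r) Z → (Z.card : ℝ) ≤ (R / r) ^ α := by
  classical
  obtain ⟨r0, R0, hr0, hrR0, hR0, x0, hx0, hsm0⟩ := small_start K hne hα hlt
    (C := (ε * δ / 2) ^ α) (by positivity)
  obtain ⟨s, hs⟩ : ∃ s, s = 2 * r0 := ⟨_, rfl⟩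
  have hs0 : 0 < s := by linarith
  rw [← hs] at hsm0
  let Small : EuclideanSpace ℝ (Fin d) → ℝ → Prop := fun x R =>
    ∀ T : Finset (EuclideanSpace ℝ (Fin d)), (T : Set _) ⊆ closedBall x R ∩ K → SepBy s T →
      (T.card : ℝ) ≤ (ε * R / s) ^ α
  have hbig : ∀ x ∈ K, ∀ R, 0 ≤ R → Small x R → s ≤ ε * R := by
    intro x hx R hR hS
    have := hS {x} (by simp [hx, hR]) (by simp [SepBy])
    simp only [Finset.card_singleton, Nat.cast_one] at this
    by_contra! hcon
    have h1 : ε * R / s < 1 := by rw [div_lt_one hs0]; exact hcon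
    have := Real.rpow_lt_one (by positivity) h1 hα
    linarith
  let W : Set ℝ := {R | 0 ≤ R ∧ R ≤ δ ∧ ∃ x ∈ K, Small x R}
  have hW0 : min R0 δ ∈ W := by
    have hR0p : 0 < R0 := by linarith
    have hmp : 0 < min R0 δ := lt_min hR0p hδ
    refine ⟨hmp.le, min_le_right _ _, x0, hx0, ?_⟩
    intro T hT hsep
    refine (hsm0 T (hT.trans (Set.inter_subset_inter_left _
      (closedBall_subset_closedBall (min_le_left _ _)))) hsep).trans ?_
    rw [← Real.mul_rpow (by positivity) (by positivity)]
    apply Real.rpow_le_rpow (by positivity) _ hα.le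
    have h1 : δ * R0 ≤ min R0 δ := le_min (by nlinarith) (by nlinarith)
    rw [hs]
    calc ε * δ / 2 * (R0 / r0) = ε * (δ * R0) / (2 * r0) := by field_simp
      _ ≤ _ := by gcongr
  have hWlb : ∀ R ∈ W, s ≤ R := by
    rintro R ⟨h1, -, x, hx, h2⟩
    have := hbig x hx R h1 h2
    nlinarith
  have hinf : s ≤ sInf W := le_csInf ⟨_, hW0⟩ hWlb
  obtain ⟨R, hRW, hRlt⟩ := exists_lt_of_csInf_lt ⟨_, hW0⟩ (show sInf W < 2 * sInf W by linarith)
  obtain ⟨hR0, hRδ, x, hx, hsm⟩ := hRW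
  refine ⟨x, hx, s, R, hs0, hbig x hx R hR0 hsm, hRδ, ?_⟩
  intro r hsr hrR Z hZ hsep
  have hr0 : 0 < r := by linarith
  by_contra! hcon
  have hnot : ∀ z ∈ Z, ¬ Small z r := by
    intro z hz hsmz
    have : r ∈ W := ⟨hr0.le, by linarith, z, (hZ hz).2, hsmz⟩
    have := csInf_le ⟨s, hWlb⟩ this
    linarith
  have hex : ∀ z, ∃ T : Finset (EuclideanSpace ℝ (Fin d)), z ∈ Z →
      (T : Set _) ⊆ closedBall z r ∩ K ∧ SepBy s T ∧ (ε * r / s) ^ α < T.card := by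
    intro z
    by_cases hz : z ∈ Z
    · have := hnot z hz
      simp only [Small] at this
      push Not at this
      obtain ⟨T, h⟩ := this
      exact ⟨T, fun _ => h⟩
    · exact ⟨∅, fun h => absurd h hz⟩
  choose T hT using hex
  have hfar : ∀ z ∈ Z, ∀ w ∈ Z, z ≠ w → ∀ a ∈ T z, ∀ b ∈ T w, s < dist a b := by
    intro z hz w hw hzw a ha b hb
    have h1 := hsep z hz w hw hzw
    have h2 : dist a z ≤ r := ((hT z hz).1 ha).1
    have h3 : dist b w ≤ r := ((hT w hw).1 hb).1
    have h4 := dist_triangle4 z a b w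
    rw [dist_comm z a] at h4
    linarith
  have hU := hsm (Z.biUnion T) ?_ ?_
  · rw [Finset.card_biUnion] at hU
    · push_cast at hU
      have h1 : (Z.card : ℝ) * (ε * r / s) ^ α ≤ ∑ z ∈ Z, ((T z).card : ℝ) := by
        rw [← nsmul_eq_mul]
        exact Finset.card_nsmul_le_sum _ _ _ (fun z hz => (hT z hz).2.2.le)
      have hR1 : 0 < R := by linarith
      have hp : 0 < (ε * r / s) ^ α := by positivity
      have h2 : (ε * R / s) ^ α = (R / r) ^ α * (ε * r / s) ^ α := by
        rw [← Real.mul_rpow (by positivity) (by positivity)]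
        congr 1
        field_simp
      have h3 := mul_lt_mul_of_pos_right hcon hp
      linarith
    · intro z hz w hw hzw
      rw [Function.onFun, Finset.disjoint_left]
      intro a ha hb
      have := hfar z hz w hw hzw a ha a hb
      simp at this
      linarith
  · intro a ha
    simp only [Finset.coe_biUnion, Set.mem_iUnion, Finset.mem_coe, exists_prop] at ha
    obtain ⟨z, hz, ha⟩ := ha
    have h1 := (hT z hz).1 ha
    have h2 : dist z x ≤ R / 2 := (hZ hz).1
    have h3 : dist a z ≤ r := h1.1
    refine ⟨?_, h1.2⟩
    rw [mem_closedBall]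
    have := dist_triangle a z x
    linarith
  · intro a ha b hb hab
    obtain ⟨z, hz, ha⟩ := Finset.mem_biUnion.1 ha
    obtain ⟨w, hw, hb⟩ := Finset.mem_biUnion.1 hb
    by_cases hzw : z = w
    · subst hzw
      exact (hT z hz).2.1 a ha b hb hab
    · exact hfar z hz w hw hzw a ha b hb

lemma key_miniset {d : ℕ} (K : Set (EuclideanSpace ℝ (Fin d))) (hne : K.Nonempty) (n : ℕ) :
    ∃ x ∈ K, ∃ lam : ℝ, (n : ℝ) + 1 ≤ lam ∧ ∀ ρ, 1 / ((n : ℝ) + 1) ≤ ρ → ρ ≤ 1 →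
      ∀ Z : Finset (EuclideanSpace ℝ (Fin d)), (Z : Set _) ⊆ miniset K x lam →
        SepBy (3 * ρ) Z → (Z.card : ℝ) ≤ (2 / ρ) ^ (lowerDim K + 1 / ((n : ℝ) + 1)) := by
  classical
  have hβ : 0 ≤ lowerDim K := Real.sSup_nonneg (fun α h => h.1.le)
  have hn : (0 : ℝ) < n + 1 := by positivity
  have hn1 : 1 / ((n : ℝ) + 1) ≤ 1 := by rw [div_le_one hn]; simp
  have hn0 : 0 < 1 / ((n : ℝ) + 1) := by positivity
  obtain ⟨x, hx, s, R, hs, hsR, hRδ, h⟩ := key_scale K hne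
    (α := lowerDim K + 1 / ((n : ℝ) + 1)) (by linarith) (by linarith)
    (δ := 1 / ((n : ℝ) + 1)) (ε := 1 / ((n : ℝ) + 1) / 2) hn0 hn1 (by linarith) (by linarith)
  have hR : 0 < R := by
    by_contra! hcon
    nlinarith
  refine ⟨x, hx, 2 / R, ?_, ?_⟩
  · rw [le_div_iff₀ hR]
    rw [le_div_iff₀ hn] at hRδ
    linarith
  intro ρ hρ hρ1 Z hZ hsep
  have hρ0 : 0 < ρ := by linarith
  let f : EuclideanSpace ℝ (Fin d) → EuclideanSpace ℝ (Fin d) := fun z => x + (R / 2) • z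
  have hfd : ∀ a b, dist (f a) (f b) = R / 2 * dist a b := by
    intro a b
    simp only [f]
    rw [dist_add_left, dist_smul₀, Real.norm_of_nonneg (by positivity)]
  have hinj : Function.Injective f := by
    intro a b hab
    have := hfd a b
    rw [hab, dist_self] at this
    have h2 : dist a b = 0 := by
      rcases mul_eq_zero.1 this.symm with h | h
      · linarith
      · exact h
    exact dist_eq_zero.1 h2
  have := h (R / 2 * ρ) ?_ ?_ (Z.image f) ?_ ?_
  · rw [Finset.card_image_of_injective _ hinj] at this
    convert this using 2
    field_simp
  · calc s ≤ _ := hsR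
      _ = R / 2 * (1 / ((n : ℝ) + 1)) := by ring
      _ ≤ _ := by gcongr
  · nlinarith
  · intro p hp
    simp only [Finset.coe_image, Set.mem_image, Finset.mem_coe] at hp
    obtain ⟨z, hz, rfl⟩ := hp
    obtain ⟨⟨y, hy, hyz⟩, hz1⟩ := hZ hz
    constructor
    · rw [mem_closedBall, dist_zero_right] at hz1
      simp only [f]
      rw [mem_closedBall, dist_self_add_left, norm_smul, Real.norm_of_nonneg (by positivity)]
      nlinarith
    · have : f z = y := by
        simp only [f]
        simp only at hyz
        rw [← hyz, smul_smul]
        have : R / 2 * (2 / R) = 1 := by field_simp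
        rw [this, one_smul]; abel
      rw [this]; exact hy
  · intro a ha b hb hab
    obtain ⟨z, hz, rfl⟩ := Finset.mem_image.1 ha
    obtain ⟨w, hw, rfl⟩ := Finset.mem_image.1 hb
    have h1 := hsep z hz w hw (fun h => hab (by rw [h]))
    rw [hfd]
    nlinarith

lemma sep_limit {X : Type*} [MetricSpace X] {E F : Set X} {ρ : ℝ}
    (hfin : hausdorffEDist F E ≠ ⊤) (hlt : hausdorffDist F E < ρ / 2)
    {T : Finset X} (hρ : 0 < ρ) (hT : (T : Set X) ⊆ F) (hsep : SepBy (4 * ρ) T) :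
    ∃ Z : Finset X, (Z : Set X) ⊆ E ∧ SepBy (3 * ρ) Z ∧ Z.card = T.card := by
  classical
  have h : ∀ t : X, ∃ y : X, t ∈ T → y ∈ E ∧ dist t y < ρ / 2 := by
    intro t
    by_cases ht : t ∈ T
    · obtain ⟨y, hy⟩ := exists_dist_lt_of_hausdorffDist_lt (hT ht) hlt hfin
      exact ⟨y, fun _ => hy⟩
    · exact ⟨t, fun h => absurd h ht⟩
  choose f hf using h
  have hd : ∀ a ∈ T, ∀ b ∈ T, a ≠ b → 3 * ρ < dist (f a) (f b) := by
    intro a ha b hb hab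
    have h1 := hsep a ha b hb hab
    have h2 := (hf a ha).2
    have h3 := (hf b hb).2
    have h4 := dist_triangle4 a (f a) (f b) b
    rw [dist_comm (f b) b] at h4
    linarith
  refine ⟨T.image f, ?_, ?_, ?_⟩
  · intro p hp
    simp only [Finset.coe_image, Set.mem_image, Finset.mem_coe] at hp
    obtain ⟨z, hz, rfl⟩ := hp
    exact (hf z hz).1
  · intro a ha b hb hab
    obtain ⟨z, hz, rfl⟩ := Finset.mem_image.1 ha
    obtain ⟨w, hw, rfl⟩ := Finset.mem_image.1 hb
    exact hd z hz w hw (fun h => hab (by rw [h]))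
  · refine Finset.card_image_of_injOn ?_
    intro a ha b hb hab
    by_contra hne
    have := hd a ha b hb hne
    rw [hab, dist_self] at this
    linarith

lemma hausdorff_finite {X : Type*} [MetricSpace X] [MeasurableSpace X] [BorelSpace X]
    {β : ℝ} (hβ : 0 ≤ β) {F : Set X}
    (h : ∀ ρ, 0 < ρ → ρ ≤ 1 → ∀ T : Finset X, (T : Set X) ⊆ F → SepBy (4 * ρ) T →
      (T.card : ℝ) ≤ (2 / ρ) ^ β) : μH[β] F < ⊤ := by
  have hex : ∀ n : ℕ, ∃ S : Finset X, (S.card : ℝ) ≤ (2 / (1 / ((n : ℝ) + 1))) ^ β ∧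
      F ⊆ ⋃ x ∈ S, closedBall x (4 * (1 / ((n : ℝ) + 1))) := by
    intro n
    have hn : (0 : ℝ) < n + 1 := by positivity
    have hn0 : 0 < 1 / ((n : ℝ) + 1) := by positivity
    have hn1 : 1 / ((n : ℝ) + 1) ≤ 1 := by rw [div_le_one hn]; simp
    obtain ⟨S, h1, h2, h3⟩ := exists_sep_cover (s := 4 * (1 / ((n : ℝ) + 1))) (A := F)
      (M := ⌊(2 / (1 / ((n : ℝ) + 1))) ^ β⌋₊) (by positivity)
      (fun T hT hs => Nat.le_floor (h _ hn0 hn1 T hT hs))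
    exact ⟨S, h _ hn0 hn1 S h1 h2, h3⟩
  choose S hS1 hS2 using hex
  have hdiam : ∀ n : ℕ, ∀ x : X, ediam (closedBall x (4 * (1 / ((n : ℝ) + 1)))) ≤
      ENNReal.ofReal (8 * (1 / ((n : ℝ) + 1))) := by
    intro n x
    refine ediam_le ?_
    intro a ha b hb
    rw [edist_dist]
    apply ENNReal.ofReal_le_ofReal
    have := dist_triangle_right a b x
    rw [mem_closedBall] at ha hb
    linarith
  have hle := Measure.hausdorffMeasure_le_liminf_sum (ι := fun n : ℕ => (S n : Set X)) β F
    (l := Filter.atTop) (fun n : ℕ => ENNReal.ofReal (8 * (1 / ((n : ℝ) + 1)))) ?_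
    (fun n i => closedBall (i : X) (4 * (1 / ((n : ℝ) + 1)))) ?_ ?_
  · refine lt_of_le_of_lt hle (lt_of_le_of_lt (b := ENNReal.ofReal (16 ^ β)) ?_
      ENNReal.ofReal_lt_top)
    refine Filter.liminf_le_of_frequently_le' (Filter.Frequently.of_forall ?_)
    intro n
    have hn : (0 : ℝ) < n + 1 := by positivity
    calc _ ≤ ∑ i : (S n : Set X), ENNReal.ofReal ((8 * (1 / ((n : ℝ) + 1))) ^ β) := by
          refine Finset.sum_le_sum (fun i _ => ?_)
          rw [← ENNReal.ofReal_rpow_of_nonneg (by positivity) hβ]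
          exact ENNReal.rpow_le_rpow (hdiam n i) hβ
      _ = ENNReal.ofReal ((S n).card * (8 * (1 / ((n : ℝ) + 1))) ^ β) := by
          rw [ENNReal.ofReal_mul (by positivity)]
          simp
      _ ≤ _ := by
          apply ENNReal.ofReal_le_ofReal
          calc _ ≤ (2 / (1 / ((n : ℝ) + 1))) ^ β * (8 * (1 / ((n : ℝ) + 1))) ^ β := by
                gcongr
                exact hS1 n
            _ = 16 ^ β := by
                rw [← Real.mul_rpow (by positivity) (by positivity)]
                congr 1
                field_simp
                norm_num
  · rw [← ENNReal.ofReal_zero]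
    apply ENNReal.tendsto_ofReal
    simpa using (tendsto_one_div_add_atTop_nhds_zero_nat (𝕜 := ℝ)).const_mul 8
  · exact Filter.Eventually.of_forall (fun n i => hdiam n i)
  · refine Filter.Eventually.of_forall (fun n p hp => ?_)
    have := hS2 n hp
    simp only [Set.mem_iUnion, exists_prop] at this
    obtain ⟨x, hx, hp⟩ := this
    exact Set.mem_iUnion.2 ⟨⟨x, hx⟩, hp⟩

/-- every nonempty compact `K ⊆ ℝᵈ` with lower dimension `β` admits a
weak tangent `F` with finite `β`-dimensional Hausdorff measure. -/
theorem statement13 {d : ℕ} (K : Set (EuclideanSpace ℝ (Fin d)))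
    (hne : K.Nonempty) (hK : IsCompact K) :
    ∃ F : Set (EuclideanSpace ℝ (Fin d)), IsWeakTangent K F ∧
      μH[lowerDim K] F < ⊤ := by
  have hβ : 0 ≤ lowerDim K := Real.sSup_nonneg (fun α h => h.1.le)
  choose x hx lam hlam hsm using key_miniset K hne
  have hmne : ∀ n, (miniset K (x n) (lam n)).Nonempty := fun n =>
    ⟨0, ⟨x n, hx n, by simp⟩, by simp⟩
  have hmc : ∀ n, IsCompact (miniset K (x n) (lam n)) := fun n =>
    (hK.image (by fun_prop)).inter_right isClosed_closedBall
  let L : ℕ → TopologicalSpace.NonemptyCompacts (EuclideanSpace ℝ (Fin d)) := fun n =>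
    ⟨⟨miniset K (x n) (lam n), hmc n⟩, hmne n⟩
  obtain ⟨F, -, φ, hφ, hlim⟩ :=
    (TopologicalSpace.NonemptyCompacts.isCompact_subsets_of_isCompact
      (isCompact_closedBall (0 : EuclideanSpace ℝ (Fin d)) 1)).tendsto_subseq (x := L)
      (fun n => (Set.inter_subset_right : miniset K (x n) (lam n) ⊆ _))
  have hdist : Filter.Tendsto (fun n => hausdorffDist
      (miniset K (x (φ n)) (lam (φ n))) (F : Set (EuclideanSpace ℝ (Fin d))))
      Filter.atTop (nhds 0) := by
    have := tendsto_iff_dist_tendsto_zero.1 hlim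
    exact this
  refine ⟨F, ⟨F.nonempty, F.isCompact, fun n => x (φ n), fun n => lam (φ n), fun n => hx _,
    fun n => ?_, ?_, fun n => hmne _, hdist⟩, ?_⟩
  · have := hlam (φ n)
    have h0 : (0 : ℝ) ≤ (φ n : ℝ) := by positivity
    linarith
  · refine Filter.tendsto_atTop_mono (fun n => ?_) tendsto_natCast_atTop_atTop
    have h1 := hlam (φ n)
    have h2 : (n : ℝ) ≤ φ n := by exact_mod_cast hφ.id_le n
    linarith
  · refine hausdorff_finite hβ ?_
    intro ρ hρ hρ1 T hT hsep
    have h0 : Filter.Tendsto (fun n => 1 / ((φ n : ℝ) + 1)) Filter.atTop (nhds 0) :=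
      (tendsto_one_div_add_atTop_nhds_zero_nat (𝕜 := ℝ)).comp hφ.tendsto_atTop
    have hlim2 : Filter.Tendsto (fun n => (2 / ρ) ^ (lowerDim K + 1 / ((φ n : ℝ) + 1)))
        Filter.atTop (nhds ((2 / ρ) ^ (lowerDim K))) := by
      have h1 := h0.const_add (lowerDim K)
      rw [add_zero] at h1
      exact tendsto_const_nhds.rpow h1 (Or.inl (by positivity))
    refine ge_of_tendsto hlim2 ?_
    filter_upwards [h0.eventually_le_const hρ, hdist.eventually_lt_const (half_pos hρ)] with n h1 h2
    have hfin : hausdorffEDist (F : Set (EuclideanSpace ℝ (Fin d)))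
        (miniset K (x (φ n)) (lam (φ n))) ≠ ⊤ :=
      hausdorffEDist_ne_top_of_nonempty_of_bounded F.nonempty (hmne _) F.isCompact.isBounded
        (hmc _).isBounded
    rw [hausdorffDist_comm] at h2
    obtain ⟨Z, hZ, hZs, hZc⟩ := sep_limit hfin h2 hρ hT hsep
    rw [← hZc]
    exact hsm (φ n) ρ h1 hρ1 Z hZ hZs
end

section
/- For every d ∈ ℕ and every α with 0 ≤ α < d, there exists a nonempty compact set K ⊂ ℝ^d with dim_A K = α such that every microset E of K has modified lower dimension 0, i.e., dim_ML E = 0. -/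
open Metric Filter
open scoped ENNReal

/-- The Assouad dimension of a set. -/
noncomputable def assouadDim {X : Type*} [MetricSpace X] (K : Set X) : ℝ :=
  sInf {α : ℝ | 0 < α ∧ ∃ C : ℝ, 0 < C ∧ ∀ r R : ℝ, 0 < r → r ≤ R → R < 1 → ∀ x ∈ K,
    (coverNum r (closedBall x R ∩ K) : ℝ≥0∞) ≤ ENNReal.ofReal (C * (R / r) ^ α)}

/-- The modified lower dimension: `sup{dim_L E : ∅ ≠ E ⊆ K}`. -/
noncomputable def modLowerDim {X : Type*} [MetricSpace X] (K : Set X) : ℝ :=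
  sSup {x : ℝ | ∃ E : Set X, E.Nonempty ∧ E ⊆ K ∧ lowerDim E = x}

/-- A microset of `K`: a Hausdorff-metric limit of nonempty minisets. -/
def IsMicroset {d : ℕ} (K E : Set (EuclideanSpace ℝ (Fin d))) : Prop :=
  E.Nonempty ∧ IsCompact E ∧ ∃ (x : ℕ → EuclideanSpace ℝ (Fin d)) (lam : ℕ → ℝ),
    (∀ n, x n ∈ K) ∧ (∀ n, 1 ≤ lam n) ∧
    (∀ n, (miniset K (x n) (lam n)).Nonempty) ∧
    Filter.Tendsto (fun n => hausdorffDist (miniset K (x n) (lam n)) E)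
      Filter.atTop (nhds 0)


lemma phi_summable (t : ℝ) (ht0 : 0 < t) (ht1 : t < 1) (u : ℕ → ℝ) (hu : ∀ k, |u k| ≤ 1) :
    Summable (fun k => u k * t ^ k) := by
  refine Summable.of_norm_bounded (summable_geometric_of_lt_one ht0.le ht1) (fun k => ?_)
  rw [Real.norm_eq_abs, abs_mul, abs_of_pos (pow_pos ht0 k)]
  exact mul_le_of_le_one_left (pow_pos ht0 k).le (hu k)

lemma phi_tail (t : ℝ) (ht0 : 0 < t) (ht1 : t < 1) (u : ℕ → ℝ) (hu : ∀ k, |u k| ≤ 1) (n : ℕ) :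
    |∑' k, u (k + n) * t ^ (k + n)| ≤ t ^ n / (1 - t) := by
  have h := (hasSum_geometric_of_lt_one ht0.le ht1).mul_left (t ^ n)
  have := tsum_of_norm_bounded (f := fun k => u (k + n) * t ^ (k + n)) h (fun k => by
    rw [Real.norm_eq_abs, abs_mul, abs_of_pos (pow_pos ht0 _), pow_add, mul_comm (t ^ n)]
    exact mul_le_of_le_one_left (by positivity) (hu _))
  simpa [div_eq_mul_inv] using this

lemma phi_upper (t : ℝ) (ht0 : 0 < t) (ht1 : t < 1) (u : ℕ → ℝ) (hu : ∀ k, |u k| ≤ 1) (n : ℕ)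
    (h0 : ∀ k < n, u k = 0) :
    |∑' k, u k * t ^ k| ≤ t ^ n / (1 - t) := by
  rw [← (phi_summable t ht0 ht1 u hu).sum_add_tsum_nat_add n,
    Finset.sum_eq_zero (fun k hk => by rw [h0 k (Finset.mem_range.1 hk), zero_mul]), zero_add]
  exact phi_tail t ht0 ht1 u hu n

lemma phi_lower (t : ℝ) (ht0 : 0 < t) (ht1 : t < 1) (u : ℕ → ℝ) (hu : ∀ k, |u k| ≤ 1) (n : ℕ)
    (h0 : ∀ k < n, u k = 0) (h1 : |u n| = 1) :
    t ^ n * ((1 - 2 * t) / (1 - t)) ≤ |∑' k, u k * t ^ k| := by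
  rw [← (phi_summable t ht0 ht1 u hu).sum_add_tsum_nat_add (n + 1), Finset.sum_range_succ,
    Finset.sum_eq_zero (fun k hk => by rw [h0 k (Finset.mem_range.1 hk), zero_mul]), zero_add]
  have h := phi_tail t ht0 ht1 u hu (n + 1)
  have h2 : |u n * t ^ n| = t ^ n := by
    rw [abs_mul, h1, one_mul, abs_of_pos (pow_pos ht0 _)]
  have h3 : t ^ n * ((1 - 2 * t) / (1 - t)) = t ^ n - t ^ (n + 1) / (1 - t) := by
    have : 1 - t ≠ 0 := by linarith
    field_simp; ring
  rw [h3]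
  set T := ∑' k, u (k + (n + 1)) * t ^ (k + (n + 1))
  have := abs_sub_abs_le_abs_sub (u n * t ^ n) (-T)
  rw [abs_neg, sub_neg_eq_add] at this
  linarith

/-- The coding map exists with the required metric properties. -/
lemma exists_coding (d : ℕ) (hd : 1 ≤ d) (S : Set ℕ) (t : ℝ) (ht0 : 0 < t) (ht : t < 1 / 2) :
    ∃ (c : ℝ) (f : (ℕ → Fin d → Bool) → EuclideanSpace ℝ (Fin d)), 0 < c ∧ c ≤ 1 ∧
      (∀ a b n, (∀ k < n, k ∈ S → a k = b k) → dist (f a) (f b) ≤ t ^ n / 2) ∧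
      (∀ a b n, dist (f a) (f b) ≤ c * t ^ n → ∀ k < n, k ∈ S → a k = b k) := by
  classical
  have ht1 : t < 1 := by linarith
  have hd' : (1 : ℝ) ≤ d := by exact_mod_cast hd
  have hd0 : (0 : ℝ) < d := by linarith
  let u : (ℕ → Fin d → Bool) → Fin d → ℕ → ℝ := fun a i k => if k ∈ S ∧ a k i = true then 1 else 0
  have hu : ∀ a i k, |u a i k| ≤ 1 := by
    intro a i k; simp only [u]; split_ifs <;> simp
  have hdu : ∀ a b i k, |u a i k - u b i k| ≤ 1 := by
    intro a b i k; simp only [u]; split_ifs <;> simp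
  let η : ℝ := (1 - t) / (2 * d)
  have hη : 0 < η := by
    have : 0 < 1 - t := by linarith
    positivity
  let f : (ℕ → Fin d → Bool) → EuclideanSpace ℝ (Fin d) :=
    fun a => WithLp.toLp 2 (fun i => η * ∑' k, u a i k * t ^ k)
  have hf : ∀ a b i, (f a - f b) i = η * ∑' k, (u a i k - u b i k) * t ^ k := by
    intro a b i
    simp only [f, PiLp.sub_apply]
    rw [← mul_sub, ← (phi_summable t ht0 ht1 _ (hu a i)).tsum_sub (phi_summable t ht0 ht1 _ (hu b i))]
    simp only [sub_mul]
  refine ⟨(1 - 2 * t) / (2 * d), f, ?_, ?_, ?_, ?_⟩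
  · have : 0 < 1 - 2 * t := by linarith
    positivity
  · rw [div_le_one (by positivity)]; linarith
  · intro a b n h
    rw [dist_eq_norm]
    have hc : ∀ i, |(f a - f b) i| ≤ t ^ n / (2 * d) := by
      intro i
      rw [hf, abs_mul, abs_of_pos hη]
      have := phi_upper t ht0 ht1 _ (hdu a b i) n (fun k hk => by
        by_cases hS : k ∈ S
        · simp [u, h k hk hS]
        · simp [u, hS])
      calc _ ≤ η * (t ^ n / (1 - t)) := mul_le_mul_of_nonneg_left this hη.le
        _ = _ := by
          have : 1 - t ≠ 0 := by linarith
          simp only [η]; field_simp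
    rw [EuclideanSpace.norm_eq]
    apply Real.sqrt_le_iff.2 ⟨by positivity, ?_⟩
    calc ∑ i, ‖(f a - f b) i‖ ^ 2 ≤ ∑ i : Fin d, (t ^ n / (2 * d)) ^ 2 :=
          Finset.sum_le_sum (fun i _ => pow_le_pow_left₀ (norm_nonneg _) (hc i) 2)
      _ = (t ^ n / 2) ^ 2 * (1 / d) := by
          simp; field_simp
      _ ≤ (t ^ n / 2) ^ 2 := mul_le_of_le_one_right (by positivity) (by
          rw [div_le_one hd0]; exact hd')
  · intro a b n h
    by_contra hcon
    push Not at hcon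
    have hex : ∃ k, k < n ∧ k ∈ S ∧ a k ≠ b k := hcon
    let m := Nat.find hex
    obtain ⟨hm, hmS, hab⟩ := Nat.find_spec hex
    have hmin : ∀ k < m, k ∈ S → a k = b k := by
      intro k hk hkS
      by_contra hne
      exact Nat.find_min hex hk ⟨hk.trans hm, hkS, hne⟩
    obtain ⟨i, hi⟩ := Function.ne_iff.1 hab
    have h1 := phi_lower t ht0 ht1 _ (hdu a b i) m (fun k hk => by
        by_cases hS : k ∈ S
        · simp [u, hmin k hk hS]
        · simp [u, hS]) (by
        have hmS' : m ∈ S := hmS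
        have hi' : a m i ≠ b m i := hi
        simp only [u, hmS', true_and]
        cases h1 : a m i <;> cases h2 : b m i <;> simp_all)
    have h2 : |(f a - f b) i| ≤ dist (f a) (f b) := by
      rw [dist_eq_norm]; exact PiLp.norm_apply_le (f a - f b) i
    rw [hf, abs_mul, abs_of_pos hη] at h2
    have h3 : η * (t ^ m * ((1 - 2 * t) / (1 - t))) = (1 - 2 * t) / (2 * d) * t ^ m := by
      have : 1 - t ≠ 0 := by linarith
      simp only [η]; field_simp
    have h4 : t ^ n < t ^ m := pow_lt_pow_right_of_lt_one₀ ht0 ht1 hm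
    have h5 : 0 < (1 - 2 * t) / (2 * d) := by
      have : 0 < 1 - 2 * t := by linarith
      positivity
    have h6 := mul_le_mul_of_nonneg_left h1 hη.le
    have h7 := mul_lt_mul_of_pos_left h4 h5
    linarith

lemma coverNum_le_card {X : Type*} [MetricSpace X] (r : ℝ) (F : Set X) (T : Finset X)
    (h1 : ↑T ⊆ F) (h2 : F ⊆ ⋃ x ∈ T, closedBall x r) : coverNum r F ≤ (T.card : ℕ∞) := by
  unfold coverNum
  exact sInf_le ⟨T, ⟨h1, h2⟩, rfl⟩

lemma coverNum_le_of_label {X ι : Type*} [MetricSpace X] [Fintype ι] (r : ℝ) (F : Set X)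
    (l : X → ι) (h : ∀ y ∈ F, ∀ z ∈ F, l y = l z → dist y z ≤ r) :
    coverNum r F ≤ (Fintype.card ι : ℕ∞) := by
  classical
  let I : Finset ι := Finset.univ.filter (fun i => ∃ y ∈ F, l y = i)
  have hI : ∀ i : I, ∃ y ∈ F, l y = i := fun i => (Finset.mem_filter.1 i.2).2
  choose g hgF hgl using hI
  let T : Finset X := Finset.univ.image g
  refine (coverNum_le_card r F T ?_ ?_).trans ?_
  · intro y hy
    obtain ⟨i, -, rfl⟩ := Finset.mem_image.1 hy
    exact hgF i
  · intro y hy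
    let i : I := ⟨l y, Finset.mem_filter.2 ⟨Finset.mem_univ _, y, hy, rfl⟩⟩
    refine Set.mem_iUnion₂.2 ⟨g i, Finset.mem_image_of_mem _ (Finset.mem_univ _), ?_⟩
    exact h y hy _ (hgF i) (hgl i).symm
  · have : T.card ≤ Fintype.card ι := by
      refine Finset.card_image_le.trans ?_
      rw [Finset.card_univ, Fintype.card_coe]
      exact Finset.card_le_univ I
    exact_mod_cast this

lemma le_coverNum_of_sep {X ι : Type*} [MetricSpace X] [Fintype ι] (r : ℝ) (F : Set X)
    (g : ι → X) (hg : ∀ i, g i ∈ F) (h : ∀ i j, i ≠ j → 2 * r < dist (g i) (g j)) :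
    (Fintype.card ι : ℕ∞) ≤ coverNum r F := by
  classical
  refine le_sInf ?_
  rintro _ ⟨T, ⟨-, hT⟩, rfl⟩
  have : ∀ i, ∃ x ∈ T, dist (g i) x ≤ r := by
    intro i
    obtain ⟨x, hx, hx'⟩ := Set.mem_iUnion₂.1 (hT (hg i))
    exact ⟨x, hx, hx'⟩
  choose s hsT hs using this
  have hinj : Function.Injective s := by
    intro i j hij
    by_contra hne
    have h1 := h i j hne
    have h2 := dist_triangle_right (g i) (g j) (s i)
    have h3 := hs i
    have h4 := hs j
    rw [← hij] at h4
    linarith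
  have : Fintype.card ι ≤ T.card := by
    rw [← Finset.card_univ, ← Finset.card_image_of_injective _ hinj]
    refine Finset.card_le_card ?_
    intro x hx
    obtain ⟨i, -, rfl⟩ := Finset.mem_image.1 hx
    exact hsT i
  show (Fintype.card ι : ℕ∞) ≤ (T.card : ℕ∞)
  exact_mod_cast this

/-- Gap property of a compact set forces all microsets to have modified lower dimension zero. -/
lemma microset_of_gap {d : ℕ} (K : Set (EuclideanSpace ℝ (Fin d)))
    (hgap : ∀ L : ℝ, 1 < L → ∃ W : ℝ, 1 ≤ W ∧ ∀ x ∈ K, ∀ ρ : ℝ, 0 < ρ → ρ ≤ 1 →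
      ∃ s : ℝ, ρ / W ≤ s ∧ s ≤ ρ ∧ ∀ y ∈ K, dist y x ≤ s → dist y x ≤ s / L)
    (E : Set (EuclideanSpace ℝ (Fin d))) (hE : IsMicroset K E) : modLowerDim E = 0 := by
  obtain ⟨hne, hcomp, x, lam, hx, hlam, hmne, hlim⟩ := hE
  -- the gap for E
  have key : ∀ L : ℝ, 1 < L → ∀ z ∈ E, ∃ R : ℝ, 0 < R ∧ R < 1 ∧
      ∀ e ∈ E, dist e z ≤ R → dist e z ≤ 4 * R / L := by
    intro L hL z hz
    obtain ⟨W, hW, hg⟩ := hgap L hL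
    have hL0 : 0 < L := by linarith
    have hW0 : 0 < W := by linarith
    have hε : 0 < 1 / (8 * W * L) := by positivity
    obtain ⟨n, hn⟩ := ((tendsto_order.1 hlim).2 _ hε).exists
    set ε := 1 / (8 * W * L) with hεdef
    have hfin : hausdorffEDist (miniset K (x n) (lam n)) E ≠ ⊤ :=
      hausdorffEDist_ne_top_of_nonempty_of_bounded (hmne n) hne
        (isBounded_closedBall.subset Set.inter_subset_right) hcomp.isBounded
    obtain ⟨z', ⟨⟨y, hyK, hyz⟩, hz'1⟩, hz'⟩ := exists_dist_lt_of_hausdorffDist_lt' hz hn hfin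
    have hl : 0 < lam n := by linarith [hlam n]
    obtain ⟨s, hs1, hs2, hs3⟩ := hg y hyK (1 / lam n) (by positivity) (by
      rw [div_le_one hl]; exact hlam n)
    set v := lam n * s with hv
    have hv1 : 1 / W ≤ v := by
      have := mul_le_mul_of_nonneg_left hs1 hl.le
      have e : lam n * (1 / lam n / W) = 1 / W := by field_simp
      linarith
    have hv2 : v ≤ 1 := by
      have := mul_le_mul_of_nonneg_left hs2 hl.le
      have e : lam n * (1 / lam n) = 1 := by field_simp
      linarith
    have hv0 : 0 < v := lt_of_lt_of_le (by positivity) hv1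
    have hεv : ε ≤ v / (8 * L) := by
      have : ε = (1 / W) / (8 * L) := by rw [hεdef]; field_simp
      rw [this]
      gcongr
    have hεv' : v / (8 * L) ≤ v / 8 := by
      apply div_le_div_of_nonneg_left hv0.le (by norm_num); linarith
    refine ⟨v / 2, by positivity, by linarith, ?_⟩
    intro e he hed
    obtain ⟨m, ⟨⟨q, hqK, hqm⟩, hm1⟩, hm⟩ := exists_dist_lt_of_hausdorffDist_lt' he hn hfin
    have hd : dist m z' = lam n * dist q y := by
      rw [← hqm, ← hyz]
      simp only
      rw [dist_smul₀, dist_sub_right, Real.norm_of_nonneg hl.le]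
    have t1 : dist m z' ≤ dist m e + dist e z + dist z z' := dist_triangle4 _ _ _ _
    have t2 : dist e z ≤ dist e m + dist m z' + dist z' z := dist_triangle4 _ _ _ _
    rw [dist_comm z' z] at t2
    rw [dist_comm e m] at t2
    have hz'' : dist z z' < ε := by first | exact hz' | (rw [dist_comm]; exact hz')
    have hm' : dist m e < ε := by first | exact hm | (rw [dist_comm]; exact hm)
    have t3 : lam n * dist q y ≤ lam n * s := by rw [← hd, ← hv]; linarith
    have t4 := hs3 q hqK (le_of_mul_le_mul_left t3 hl)
    have t5 : dist m z' ≤ v / L := by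
      rw [hd, hv, mul_div_assoc]; exact mul_le_mul_of_nonneg_left t4 hl.le
    have e1 : 4 * (v / 2) / L = 2 * (v / L) := by ring
    have e2 : v / (8 * L) = (v / L) / 8 := by field_simp
    have : 0 < v / L := by positivity
    rw [e1]; rw [e2] at hεv
    linarith
  have hlow : ∀ F : Set (EuclideanSpace ℝ (Fin d)), F.Nonempty → F ⊆ E → lowerDim F = 0 := by
    intro F hF hFE
    have : {α : ℝ | 0 < α ∧ ∃ C : ℝ, 0 < C ∧ ∀ r R : ℝ, 0 < r → r ≤ R → R < 1 → ∀ x ∈ F,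
        ENNReal.ofReal (C * (R / r) ^ α) ≤ (coverNum r (closedBall x R ∩ F) : ℝ≥0∞)} = ∅ := by
      rw [Set.eq_empty_iff_forall_notMem]
      rintro β ⟨hβ, C, hC, h⟩
      obtain ⟨z, hz⟩ := hF
      have ht : Tendsto (fun L : ℝ => C * L ^ β) atTop atTop :=
        (tendsto_rpow_atTop hβ).const_mul_atTop hC
      obtain ⟨L, hL1, hL2⟩ := ((ht.eventually_gt_atTop 1).and (eventually_gt_atTop 1)).exists
      obtain ⟨R, hR0, hR1, hR⟩ := key (4 * L) (by linarith) z (hFE hz)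
      have hL0 : 0 < L := by linarith
      have h1 := h (R / L) R (by positivity) (div_le_self hR0.le hL2.le) hR1 z hz
      have h2 : coverNum (R / L) (closedBall z R ∩ F) ≤ 1 := by
        refine (coverNum_le_card _ _ {z} ?_ ?_).trans (by simp)
        · simp [hz, hR0.le]
        · rintro e ⟨he, heF⟩
          have := hR e (hFE heF) he
          simp only [Finset.mem_singleton, Set.iUnion_iUnion_eq_left, mem_closedBall]
          rwa [mul_div_mul_left _ _ (by norm_num : (4 : ℝ) ≠ 0)] at this
      have h3 : R / (R / L) = L := by field_simp
      rw [h3] at h1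
      have h4 : (coverNum (R / L) (closedBall z R ∩ F) : ℝ≥0∞) ≤ 1 := by
        have := ENat.toENNReal_le.2 h2
        simpa using this
      have h5 := ENNReal.ofReal_le_one.1 (h1.trans h4)
      linarith
    rw [lowerDim, this, Real.sSup_empty]
  have : {x : ℝ | ∃ F : Set (EuclideanSpace ℝ (Fin d)), F.Nonempty ∧ F ⊆ E ∧ lowerDim F = x} = {0} := by
    ext y
    constructor
    · rintro ⟨F, hF, hFE, rfl⟩
      exact hlow F hF hFE
    · rintro rfl
      exact ⟨E, hne, subset_rfl, hlow E hne subset_rfl⟩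
  rw [modLowerDim, this, csSup_singleton]

open Classical in
/-- number of elements of `S` in `[m, p)`. -/
noncomputable def cnt (S : Set ℕ) (m p : ℕ) : ℕ := ((Finset.Ico m p).filter (· ∈ S)).card

lemma cnt_le (S : Set ℕ) (m w : ℕ) : cnt S m (m + w) ≤ w := by
  classical
  refine (Finset.card_filter_le _ _).trans ?_
  simp

lemma cnt_add (S : Set ℕ) (m v w : ℕ) :
    cnt S m (m + (v + w)) = cnt S m (m + v) + cnt S (m + v) (m + v + w) := by
  classical
  unfold cnt
  rw [← Finset.card_union_of_disjoint, ← Finset.filter_union, Finset.Ico_union_Ico_eq_Ico, add_assoc]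
  · omega
  · omega
  · apply Finset.disjoint_filter_filter
    exact Finset.Ico_disjoint_Ico_consecutive _ _ _

/-- Banach density. -/
lemma exists_banach (S : Set ℕ) (τ : ℝ) (hτ : ∀ N, τ * N ≤ cnt S 0 N) :
    ∃ σ : ℝ, τ ≤ σ ∧ (∀ w, ∃ m, σ * w ≤ cnt S m (m + w)) ∧
      (∀ ε > 0, ∃ C : ℝ, ∀ m w, (cnt S m (m + w) : ℝ) ≤ (σ + ε) * w + C) := by
  let A : ℕ → ℕ := fun w => sSup (Set.range fun m => cnt S m (m + w))
  have hb : ∀ w, BddAbove (Set.range fun m => cnt S m (m + w)) := by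
    intro w
    refine ⟨w, ?_⟩
    rintro _ ⟨m, rfl⟩
    exact cnt_le S m w
  have hA : ∀ m w, cnt S m (m + w) ≤ A w := fun m w => le_csSup (hb w) ⟨m, rfl⟩
  have hA' : ∀ w, ∃ m, cnt S m (m + w) = A w := fun w => Nat.sSup_mem (Set.range_nonempty _) (hb w)
  have hAw : ∀ w, A w ≤ w := by
    intro w
    obtain ⟨m, hm⟩ := hA' w
    rw [← hm]; exact cnt_le S m w
  have hsub : Subadditive (fun w => (A w : ℝ)) := by
    intro v w
    obtain ⟨m, hm⟩ := hA' (v + w)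
    have := hA m v
    have := hA (m + v) w
    rw [cnt_add] at hm
    have h3 : A (v + w) ≤ A v + A w := by omega
    show (A (v + w) : ℝ) ≤ A v + A w
    exact_mod_cast h3
  have hbd : BddBelow (Set.range fun n : ℕ => (A n : ℝ) / n) := by
    refine ⟨0, ?_⟩
    rintro _ ⟨n, rfl⟩
    positivity
  have hlim := hsub.tendsto_lim hbd
  refine ⟨hsub.lim, ?_, ?_, ?_⟩
  · refine ge_of_tendsto hlim ?_
    filter_upwards [eventually_gt_atTop 0] with n hn
    have hn' : (0 : ℝ) < n := by exact_mod_cast hn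
    rw [le_div_iff₀ hn']
    refine (hτ n).trans ?_
    have := hA 0 n
    rw [zero_add] at this
    exact_mod_cast this
  · intro w
    obtain ⟨m, hm⟩ := hA' w
    refine ⟨m, ?_⟩
    rw [hm]
    rcases Nat.eq_zero_or_pos w with rfl | hw
    · simp
    · have := hsub.lim_le_div hbd hw.ne'
      have hw' : (0 : ℝ) < w := by exact_mod_cast hw
      rwa [le_div_iff₀ hw'] at this
  · intro ε hε
    have h1 := (tendsto_order.1 hlim).2 (hsub.lim + ε) (by linarith)
    obtain ⟨n0, hn0⟩ := eventually_atTop.1 h1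
    have hl0 : 0 ≤ hsub.lim := ge_of_tendsto' hlim (fun n => by positivity)
    refine ⟨n0, fun m w => ?_⟩
    have hmw : (cnt S m (m + w) : ℝ) ≤ A w := by exact_mod_cast hA m w
    rcases Nat.eq_zero_or_pos w with rfl | hw
    · have : (cnt S m (m + 0) : ℝ) ≤ (0 : ℕ) := by exact_mod_cast cnt_le S m 0
      simp at this ⊢
      rw [this]; positivity
    have hw' : (0 : ℝ) < w := by exact_mod_cast hw
    rcases le_total n0 w with h | h
    · have := hn0 w h
      rw [div_lt_iff₀ hw'] at this
      have : (0 : ℝ) ≤ n0 := by positivity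
      linarith
    · have h2 : (A w : ℝ) ≤ w := by exact_mod_cast hAw w
      have h3 : (w : ℝ) ≤ n0 := by exact_mod_cast h
      have : 0 ≤ (hsub.lim + ε) * w := by positivity
      linarith

lemma bad_count (P j N : ℕ) (hj : 2 * j ≤ P) (hP : 0 < P) :
    ((Finset.range N).filter (fun n => P ≤ n % P + j)).card * P ≤ 2 * j * N := by
  have h1 : ((Finset.range N).filter (fun n => P ≤ n % P + j)).card ≤
      (Finset.range ((N + j) / P) ×ˢ Finset.range j).card := by
    refine Finset.card_le_card_of_injOn (fun n => (n / P, n % P + j - P)) ?_ ?_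
    · intro n hn
      simp only [Finset.coe_filter, Finset.mem_range, Set.mem_ofPred_eq] at hn
      simp only [Finset.coe_product, Finset.coe_range, Set.mem_prod, Set.mem_Iio]
      have h2 := Nat.mod_lt n hP
      have h3 := Nat.div_add_mod n P
      refine ⟨?_, by omega⟩
      rw [Nat.lt_iff_add_one_le, Nat.le_div_iff_mul_le hP]
      have : (n / P + 1) * P = P * (n / P) + P := by ring
      omega
    · intro n hn m hm h
      simp only [Finset.coe_filter, Finset.mem_range, Set.mem_ofPred_eq] at hn hm
      simp only [Prod.mk.injEq] at h
      rw [← Nat.div_add_mod n P, ← Nat.div_add_mod m P, h.1]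
      omega
  rw [Finset.card_product, Finset.card_range, Finset.card_range] at h1
  have h2 : (N + j) / P * P ≤ N + j := Nat.div_mul_le_self _ _
  rcases lt_or_ge (N + j) P with h | h
  · rw [Nat.div_eq_of_lt h] at h1
    rw [zero_mul, Nat.le_zero] at h1
    rw [h1, zero_mul]
    exact Nat.zero_le _
  · calc _ ≤ ((N + j) / P * j) * P := Nat.mul_le_mul_right _ h1
      _ = ((N + j) / P * P) * j := by ring
      _ ≤ (2 * N) * j := Nat.mul_le_mul_right _ (by omega)
      _ = _ := by ring

lemma exists_S (M : ℕ) (hM : 1 ≤ M) : ∃ S : Set ℕ, (∀ N, (1 - 1 / (M : ℝ)) * N ≤ cnt S 0 N) ∧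
    ∀ L : ℕ, ∃ Q : ℕ, ∀ m, ∃ n, m ≤ n ∧ n ≤ m + Q ∧ ∀ k, n ≤ k → k < n + L → k ∉ S := by
  classical
  let P : ℕ → ℕ := fun j => M * j * 2 ^ (j + 1)
  have hP2 : ∀ j, 2 * j ≤ P j := by
    intro j
    have : 1 ≤ 2 ^ j := Nat.one_le_two_pow
    calc 2 * j = 1 * j * (2 * 1) := by ring
      _ ≤ M * j * (2 * 2 ^ j) := by gcongr
      _ = P j := by simp only [P]; ring
  refine ⟨{n | ∀ j, 1 ≤ j → n % P j + j < P j}, ?_, ?_⟩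
  · intro N
    set S : Set ℕ := {n | ∀ j, 1 ≤ j → n % P j + j < P j}
    let B : ℕ → Finset ℕ := fun j => (Finset.range N).filter (fun n => P j ≤ n % P j + j)
    have hM' : (0 : ℝ) < M := by exact_mod_cast hM
    have hB : ∀ j, 1 ≤ j → ((B j).card : ℝ) ≤ (N / M) * (1 / 2) ^ j := by
      intro j hj
      have hPj : 0 < P j := by have := hP2 j; omega
      have := bad_count (P j) j N (hP2 j) hPj
      have h2 : ((B j).card : ℝ) * P j ≤ 2 * j * N := by exact_mod_cast this
      have h3 : (P j : ℝ) = M * j * 2 ^ (j + 1) := by simp [P]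
      have hj' : (0 : ℝ) < j := by exact_mod_cast hj
      rw [h3, ← le_div_iff₀ (by positivity)] at h2
      refine h2.trans (le_of_eq ?_)
      rw [one_div, inv_pow]
      field_simp
      ring
    have hcard : (cnt S 0 N : ℝ) + ∑ j ∈ Finset.Icc 1 N, ((B j).card : ℝ) ≥ N := by
      have hsub : Finset.range N ⊆ ((Finset.Ico 0 N).filter (· ∈ S)) ∪ (Finset.Icc 1 N).biUnion B := by
        intro n hn
        rw [Finset.mem_union, Finset.mem_filter, Finset.mem_biUnion]
        by_cases hS : n ∈ S
        · left; simpa [hS] using hn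
        · right
          simp only [S, Set.mem_ofPred_eq] at hS
          push Not at hS
          obtain ⟨j, hj, hjn⟩ := hS
          have hn' := Finset.mem_range.1 hn
          refine ⟨j, ?_, ?_⟩
          · rw [Finset.mem_Icc]
            have := hP2 j
            have := Nat.mod_le n (P j)
            omega
          · simp only [B, Finset.mem_filter]
            exact ⟨hn, hjn⟩
      have h1 := (Finset.card_le_card hsub).trans (Finset.card_union_le _ _)
      have h2 : ((Finset.Icc 1 N).biUnion B).card ≤ ∑ j ∈ Finset.Icc 1 N, (B j).card :=
        Finset.card_biUnion_le
      rw [Finset.card_range] at h1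
      have h3 : N ≤ cnt S 0 N + ∑ j ∈ Finset.Icc 1 N, (B j).card := by
        unfold cnt
        omega
      exact_mod_cast h3
    have hgeo : ∑ j ∈ Finset.Icc 1 N, ((1 : ℝ) / 2) ^ j ≤ 1 := by
      have h1 : ∀ n : ℕ, ∑ j ∈ Finset.Icc 1 n, ((1 : ℝ) / 2) ^ j = 1 - (1 / 2) ^ n := by
        intro n
        induction n with
        | zero => simp
        | succ k ih => rw [Finset.sum_Icc_succ_top (by omega), ih]; ring
      rw [h1]
      have : (0 : ℝ) < (1 / 2) ^ N := by positivity
      linarith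
    have hsum : ∑ j ∈ Finset.Icc 1 N, ((B j).card : ℝ) ≤ N / M := by
      calc _ ≤ ∑ j ∈ Finset.Icc 1 N, ((N : ℝ) / M) * (1 / 2) ^ j :=
            Finset.sum_le_sum (fun j hj => hB j (Finset.mem_Icc.1 hj).1)
        _ = (N / M) * ∑ j ∈ Finset.Icc 1 N, ((1 : ℝ) / 2) ^ j := by rw [Finset.mul_sum]
        _ ≤ (N / M) * 1 := by gcongr
        _ = _ := mul_one _
    have : (1 - 1 / (M : ℝ)) * N = N - N / M := by ring
    linarith
  · intro L
    rcases Nat.eq_zero_or_pos L with rfl | hL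
    · exact ⟨0, fun m => ⟨m, le_rfl, le_rfl, fun k h1 h2 => by omega⟩⟩
    have h2 := hP2 L
    have hpos : 0 < P L := by omega
    refine ⟨2 * P L, fun m => ⟨P L * (m / P L) + 2 * P L - L, ?_, ?_, ?_⟩⟩
    · have := Nat.div_add_mod m (P L)
      have := Nat.mod_lt m hpos
      omega
    · have := Nat.div_add_mod m (P L)
      omega
    · intro k hk1 hk2 hkS
      have := hkS L hL
      have e : k = (k - P L * (m / P L + 1)) + P L * (m / P L + 1) := by
        have : P L * (m / P L + 1) = P L * (m / P L) + P L := by ring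
        omega
      have e2 : P L * (m / P L + 1) = P L * (m / P L) + P L := by ring
      rw [e, Nat.add_mul_mod_self_left, Nat.mod_eq_of_lt (by omega)] at this
      omega


open Classical in
lemma card_win (S : Set ℕ) (d m p : ℕ) :
    Fintype.card (((Finset.Ico m p).filter (· ∈ S) : Finset ℕ) → Fin d → Bool)
      = 2 ^ (d * cnt S m p) := by
  rw [Fintype.card_fun, Fintype.card_fun, Fintype.card_bool, Fintype.card_coe, Fintype.card_fin,
    ← pow_mul]
  rfl

section main
variable {d : ℕ} {S : Set ℕ} {t c : ℝ} {f : (ℕ → Fin d → Bool) → EuclideanSpace ℝ (Fin d)}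

lemma coding_compact (ht0 : 0 < t) (ht1 : t < 1)
    (h1 : ∀ a b n, (∀ k < n, k ∈ S → a k = b k) → dist (f a) (f b) ≤ t ^ n / 2) :
    IsCompact (Set.range f) := by
  refine isCompact_range ?_
  rw [continuous_iff_continuousAt]
  intro a
  rw [ContinuousAt, Metric.tendsto_nhds]
  intro ε hε
  obtain ⟨n, hn⟩ := exists_pow_lt_of_lt_one hε ht1
  have : ∀ᶠ b in nhds a, ∀ k ∈ Finset.range n, b k = a k := by
    rw [Finset.eventually_all]
    intro k _
    have : Tendsto (fun b : ℕ → Fin d → Bool => b k) (nhds a) (nhds (a k)) :=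
      (continuous_apply k).continuousAt
    rw [nhds_discrete (Fin d → Bool)] at this
    exact (tendsto_pure.1 this)
  filter_upwards [this] with b hb
  have := h1 b a n (fun k hk _ => hb k (Finset.mem_range.2 hk))
  have : 0 < t ^ n := pow_pos ht0 n
  linarith

lemma coding_gap (ht0 : 0 < t) (ht1 : t < 1) (hc0 : 0 < c) (hc1 : c ≤ 1)
    (h1 : ∀ a b n, (∀ k < n, k ∈ S → a k = b k) → dist (f a) (f b) ≤ t ^ n / 2)
    (h2 : ∀ a b n, dist (f a) (f b) ≤ c * t ^ n → ∀ k < n, k ∈ S → a k = b k)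
    (hS : ∀ L : ℕ, ∃ Q : ℕ, ∀ m, ∃ n, m ≤ n ∧ n ≤ m + Q ∧ ∀ k, n ≤ k → k < n + L → k ∉ S) :
    ∀ L : ℝ, 1 < L → ∃ W : ℝ, 1 ≤ W ∧ ∀ x ∈ Set.range f, ∀ ρ : ℝ, 0 < ρ → ρ ≤ 1 →
      ∃ s : ℝ, ρ / W ≤ s ∧ s ≤ ρ ∧ ∀ y ∈ Set.range f, dist y x ≤ s → dist y x ≤ s / L := by
  intro L hL
  have hL0 : 0 < L := by linarith
  obtain ⟨l, hl⟩ := exists_pow_lt_of_lt_one (show 0 < c / L by positivity) ht1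
  obtain ⟨Q, hQ⟩ := hS l
  have hw : c * t * t ^ Q ≤ 1 := by
    have : t ^ Q ≤ 1 := pow_le_one₀ ht0.le ht1.le
    have : c * t ≤ 1 := mul_le_one₀ hc1 ht0.le ht1.le
    exact mul_le_one₀ this (by positivity) (by assumption)
  have hw0 : 0 < c * t * t ^ Q := by positivity
  refine ⟨1 / (c * t * t ^ Q), (one_le_div hw0).2 hw, ?_⟩
  rintro _ ⟨a, rfl⟩ ρ hρ0 hρ1
  obtain ⟨m, hm1, hm2⟩ := exists_nat_pow_near_of_lt_one hρ0 hρ1 ht0 ht1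
  obtain ⟨n, hn1, hn2, hn3⟩ := hQ (m + 1)
  refine ⟨c * t ^ n, ?_, ?_, ?_⟩
  · have e1 : t ^ (m + 1 + Q) ≤ t ^ n := pow_le_pow_of_le_one ht0.le ht1.le hn2
    have e2 : t ^ (m + 1 + Q) = t ^ m * (t * t ^ Q) := by ring
    have e3 : ρ * (t * t ^ Q) ≤ t ^ m * (t * t ^ Q) := by gcongr
    calc ρ / (1 / (c * t * t ^ Q)) = c * (ρ * (t * t ^ Q)) := by field_simp
      _ ≤ c * t ^ n := by gcongr; linarith
  · have e1 : t ^ n ≤ t ^ (m + 1) := pow_le_pow_of_le_one ht0.le ht1.le hn1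
    have e2 : c * t ^ n ≤ 1 * t ^ n := by gcongr
    linarith
  · rintro _ ⟨b, rfl⟩ hb
    have hag := h2 _ _ _ hb
    have := h1 b a (n + l) (fun k hk hkS => by
      rcases lt_or_ge k n with h | h
      · exact hag k h hkS
      · exact absurd hkS (hn3 k h hk))
    have e : t ^ (n + l) ≤ t ^ n * (c / L) := by rw [pow_add]; gcongr
    have e2 : t ^ n * (c / L) = c * t ^ n / L := by ring
    have : 0 < t ^ (n + l) := by positivity
    linarith

lemma coding_upper (ht0 : 0 < t) (ht1 : t < 1) (hc0 : 0 < c) (hc1 : c ≤ 1)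
    (h1 : ∀ a b n, (∀ k < n, k ∈ S → a k = b k) → dist (f a) (f b) ≤ t ^ n / 2)
    (h2 : ∀ a b n, dist (f a) (f b) ≤ c * t ^ n → ∀ k < n, k ∈ S → a k = b k)
    (β B : ℝ) (hβ : 0 < β) (hB : 0 < B)
    (hcnt : ∀ m w, (2 : ℝ) ^ (d * cnt S m (m + w)) ≤ B * ((t ^ w)⁻¹) ^ β) :
    ∃ C : ℝ, 0 < C ∧ ∀ r R : ℝ, 0 < r → r ≤ R → R < 1 → ∀ x ∈ Set.range f,
    (coverNum r (closedBall x R ∩ Set.range f) : ℝ≥0∞) ≤ ENNReal.ofReal (C * (R / r) ^ β) := by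
  classical
  refine ⟨B * (1 / (c * t * t)) ^ β, by positivity, ?_⟩
  rintro r R hr hrR hR x ⟨a, rfl⟩
  have hR0 : 0 < R := hr.trans_le hrR
  obtain ⟨m, hmR, hm⟩ : ∃ m, (R ≤ c * t ^ m ∨ m = 0) ∧ c * t * t ^ m ≤ R := by
    rcases le_or_gt R c with h | h
    · obtain ⟨m, hm1, hm2⟩ := exists_nat_pow_near_of_lt_one (show 0 < R / c by positivity)
        ((div_le_one hc0).2 h) ht0 ht1
      refine ⟨m, Or.inl ?_, ?_⟩
      · rw [div_le_iff₀ hc0] at hm2; linarith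
      · rw [lt_div_iff₀ hc0, pow_succ] at hm1; nlinarith
    · refine ⟨0, Or.inr rfl, ?_⟩
      have : c * t ≤ c * 1 := by gcongr
      simp; linarith
  obtain ⟨q, hq1, hq2⟩ := exists_nat_pow_near_of_lt_one hr (hrR.trans hR.le) ht0 ht1
  have hmp : m ≤ q + 1 := by
    rcases hmR with h | h
    · have e : t ^ (q + 1) < t ^ m := by
        have : c * t ^ m ≤ 1 * t ^ m := by gcongr
        linarith
      exact ((pow_lt_pow_iff_right_of_lt_one₀ ht0 ht1).1 e).le
    · omega
  obtain ⟨w, hw⟩ := Nat.exists_eq_add_of_le hmp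
  let g : EuclideanSpace ℝ (Fin d) → (ℕ → Fin d → Bool) := Function.invFun f
  have hg : ∀ y ∈ Set.range f, f (g y) = y := fun y hy => Function.invFun_eq hy
  have hag : ∀ y ∈ closedBall (f a) R ∩ Set.range f, ∀ k < m, k ∈ S → g y k = a k := by
    rintro y ⟨hy, hyf⟩ k hk hkS
    rcases hmR with h | h
    · refine h2 (g y) a m ?_ k hk hkS
      rw [hg y hyf]; exact (mem_closedBall.1 hy).trans h
    · omega
  have hcov := coverNum_le_of_label r (closedBall (f a) R ∩ Set.range f)
    (fun y => (fun k : ((Finset.Ico m (m + w)).filter (· ∈ S) : Finset ℕ) => g y k)) (by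
      intro y hy z hz hyz
      have := h1 (g y) (g z) (m + w) (fun k hk hkS => by
        rcases lt_or_ge k m with h | h
        · rw [hag y hy k h hkS, hag z hz k h hkS]
        · exact congrFun hyz ⟨k, Finset.mem_filter.2 ⟨Finset.mem_Ico.2 ⟨h, hk⟩, hkS⟩⟩)
      rw [hg y hy.2, hg z hz.2, ← hw] at this
      have : 0 < t ^ (q + 1) := by positivity
      linarith)
  rw [card_win] at hcov
  have hcov' := ENat.toENNReal_le.2 hcov
  refine hcov'.trans ?_
  have hreal : (2 : ℝ) ^ (d * cnt S m (m + w)) ≤ B * (1 / (c * t * t)) ^ β * (R / r) ^ β := by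
    refine (hcnt m w).trans ?_
    rw [mul_assoc, ← Real.mul_rpow (by positivity) (by positivity)]
    gcongr
    have e1 : t ^ (q + 1) = t ^ m * t ^ w := by rw [hw, pow_add]
    have e2 : t * r ≤ t ^ m * t ^ w := by
      rw [← e1, pow_succ, mul_comm]; gcongr
    have htw : 0 < t ^ w := by positivity
    have htm : 0 < t ^ m := by positivity
    rw [← one_div, div_mul_div_comm, one_mul, div_le_div_iff₀ htw (by positivity), one_mul]
    calc c * t * t * r = c * t * (t * r) := by ring
      _ ≤ c * t * (t ^ m * t ^ w) := by gcongr
      _ = (c * t * t ^ m) * t ^ w := by ring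
      _ ≤ R * t ^ w := by gcongr
  have : ((((2 ^ (d * cnt S m (m + w)) : ℕ) : ℕ∞)) : ℝ≥0∞)
      = ENNReal.ofReal ((2 : ℝ) ^ (d * cnt S m (m + w))) := by
    rw [ENat.toENNReal_coe, ← ENNReal.ofReal_natCast]
    push_cast
    rfl
  rw [this]
  exact ENNReal.ofReal_le_ofReal hreal

lemma coding_lower (ht0 : 0 < t) (ht1 : t < 1) (hc0 : 0 < c) (hc1 : c ≤ 1)
    (h1 : ∀ a b n, (∀ k < n, k ∈ S → a k = b k) → dist (f a) (f b) ≤ t ^ n / 2)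
    (h2 : ∀ a b n, dist (f a) (f b) ≤ c * t ^ n → ∀ k < n, k ∈ S → a k = b k)
    (α β : ℝ) (hβα : β < α)
    (hcnt : ∀ w, ∃ m, ((t ^ w)⁻¹) ^ α ≤ (2 : ℝ) ^ (d * cnt S m (m + w)))
    (C : ℝ) (hC : 0 < C)
    (h : ∀ r R : ℝ, 0 < r → r ≤ R → R < 1 → ∀ x ∈ Set.range f,
    (coverNum r (closedBall x R ∩ Set.range f) : ℝ≥0∞) ≤ ENNReal.ofReal (C * (R / r) ^ β)) :
    False := by
  classical
  have key : ∀ w : ℕ, ((t ^ w)⁻¹) ^ (α - β) ≤ C * (1 / c) ^ β := by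
    intro w
    obtain ⟨m, hm⟩ := hcnt w
    have htw : 0 < t ^ w := by positivity
    have htm : 0 < t ^ m := by positivity
    have htm1 : t ^ m ≤ 1 := pow_le_one₀ ht0.le ht1.le
    have htw1 : t ^ w ≤ 1 := pow_le_one₀ ht0.le ht1.le
    let a : ℕ → Fin d → Bool := fun _ _ => false
    have hh := h (c * t ^ (m + w) / 2) (t ^ m / 2) (by positivity) (by
      rw [pow_add]
      have : c * (t ^ m * t ^ w) ≤ 1 * (t ^ m * 1) := by gcongr
      linarith) (by linarith) (f a) ⟨a, rfl⟩
    let ext : (((Finset.Ico m (m + w)).filter (· ∈ S) : Finset ℕ) → Fin d → Bool) →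
        (ℕ → Fin d → Bool) := fun g k => if hk : k ∈ (Finset.Ico m (m + w)).filter (· ∈ S) then
          g ⟨k, hk⟩ else a k
    have hcov := le_coverNum_of_sep (c * t ^ (m + w) / 2) (closedBall (f a) (t ^ m / 2) ∩ Set.range f)
      (fun g => f (ext g)) (by
        intro g
        refine ⟨?_, ⟨_, rfl⟩⟩
        rw [mem_closedBall]
        refine h1 _ _ _ (fun k hk _ => ?_)
        have : k ∉ (Finset.Ico m (m + w)).filter (· ∈ S) := by
          simp only [Finset.mem_filter, Finset.mem_Ico]; omega
        simp only [ext, this, dif_neg, not_false_eq_true]) (by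
        intro g g' hne
        by_contra hcon
        push Not at hcon
        have := h2 (ext g) (ext g') (m + w) (by linarith)
        apply hne
        funext ⟨k, hk⟩
        have hk' := Finset.mem_filter.1 hk
        have := this k (Finset.mem_Ico.1 hk'.1).2 hk'.2
        simpa only [ext, hk, dif_pos] using this)
    rw [card_win] at hcov
    have h3 := (ENat.toENNReal_le.2 hcov).trans hh
    have : ((((2 ^ (d * cnt S m (m + w)) : ℕ) : ℕ∞)) : ℝ≥0∞)
        = ENNReal.ofReal ((2 : ℝ) ^ (d * cnt S m (m + w))) := by
      rw [ENat.toENNReal_coe, ← ENNReal.ofReal_natCast]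
      push_cast
      rfl
    rw [this, ENNReal.ofReal_le_ofReal_iff (by positivity)] at h3
    have h4 := hm.trans h3
    have e : t ^ m / 2 / (c * t ^ (m + w) / 2) = (1 / c) * (t ^ w)⁻¹ := by
      rw [pow_add]; field_simp
    rw [e, Real.mul_rpow (by positivity) (by positivity), ← mul_assoc] at h4
    rw [Real.rpow_sub (by positivity), div_le_iff₀ (by positivity)]
    exact h4
  have hlim : Tendsto (fun w : ℕ => ((t ^ w)⁻¹) ^ (α - β)) atTop atTop := by
    refine (tendsto_rpow_atTop (by linarith)).comp ?_
    have : Tendsto (fun w : ℕ => (t⁻¹) ^ w) atTop atTop :=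
      tendsto_pow_atTop_atTop_of_one_lt ((one_lt_inv₀ ht0).2 ht1)
    simpa only [inv_pow] using this
  obtain ⟨w, hw⟩ := (hlim.eventually_gt_atTop (C * (1 / c) ^ β)).exists
  exact absurd (key w) (not_le.2 hw)

end main

lemma main_zero (d : ℕ) : ∃ K : Set (EuclideanSpace ℝ (Fin d)), K.Nonempty ∧ IsCompact K ∧
      assouadDim K = 0 ∧ ∀ E, IsMicroset K E → modLowerDim E = 0 := by
  refine ⟨{0}, Set.singleton_nonempty _, isCompact_singleton, ?_, ?_⟩
  · have : {α : ℝ | 0 < α ∧ ∃ C : ℝ, 0 < C ∧ ∀ r R : ℝ, 0 < r → r ≤ R → R < 1 →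
        ∀ x ∈ ({0} : Set (EuclideanSpace ℝ (Fin d))),
        (coverNum r (closedBall x R ∩ {0}) : ℝ≥0∞) ≤ ENNReal.ofReal (C * (R / r) ^ α)}
        = Set.Ioi 0 := by
      ext β
      refine ⟨fun h => h.1, fun hβ => ⟨hβ, 1, one_pos, ?_⟩⟩
      rintro r R hr hrR hR x rfl
      have h2 : coverNum r (closedBall (0 : EuclideanSpace ℝ (Fin d)) R ∩ {0}) ≤ 1 := by
        refine (coverNum_le_card _ _ {0} ?_ ?_).trans (by simp)
        · simp [(hr.trans_le hrR).le]
        · rintro e ⟨he, rfl⟩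
          simp [hr.le]
      have h4 := ENat.toENNReal_le.2 h2
      refine h4.trans ?_
      rw [one_mul]
      simp only [ENat.toENNReal_one]
      rw [← ENNReal.ofReal_one]
      exact ENNReal.ofReal_le_ofReal
        (Real.one_le_rpow ((one_le_div hr).2 hrR) (le_of_lt hβ))
    rw [assouadDim, this, csInf_Ioi]
  · refine microset_of_gap _ (fun L hL => ⟨1, le_rfl, ?_⟩)
    rintro x rfl ρ hρ0 hρ1
    refine ⟨ρ, by simp, le_rfl, ?_⟩
    rintro y rfl _
    have : 0 < L := by linarith
    simp; positivity

/-- for every `d` and `0 ≤ α < d` there is a nonempty compact `K ⊆ ℝᵈ`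
with `dim_A K = α` all of whose microsets have modified lower dimension `0`. -/
theorem statement17 (d : ℕ) (hd : 1 ≤ d) (α : ℝ) (hα : 0 ≤ α) (hαd : α < d) :
    ∃ K : Set (EuclideanSpace ℝ (Fin d)), K.Nonempty ∧ IsCompact K ∧
      assouadDim K = α ∧ ∀ E, IsMicroset K E → modLowerDim E = 0 := by
  rcases hα.eq_or_lt with rfl | hα0
  · exact main_zero d
  have hd0 : (0 : ℝ) < d := hα0.trans hαd
  have hρ : 0 < 1 - α / d := by
    have := (div_lt_one hd0).2 hαd
    linarith
  obtain ⟨M, hM⟩ := exists_nat_one_div_lt hρ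
  obtain ⟨S, hS1, hS2⟩ := exists_S (M + 1) (by omega)
  obtain ⟨σ, hσ1, hσ2, hσ3⟩ := exists_banach S _ hS1
  have hσ : α / d < σ := by push_cast at hσ1; linarith
  have hσ0 : 0 < σ := lt_trans (by positivity) hσ
  have hq : 1 < d * σ / α := by
    rw [div_lt_iff₀ hd0] at hσ
    rw [one_lt_div hα0]; linarith
  -- the contraction ratio
  set t : ℝ := (2 : ℝ) ^ (-(d * σ / α)) with ht
  have ht0 : 0 < t := by positivity
  have ht2 : t < 1 / 2 := by
    calc t < (2 : ℝ) ^ (-1 : ℝ) := Real.rpow_lt_rpow_of_exponent_lt (by norm_num) (by linarith)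
      _ = 1 / 2 := by rw [Real.rpow_neg_one]; norm_num
  have ht1 : t < 1 := by linarith
  have htpow : ∀ (w : ℕ) (β : ℝ), ((t ^ w)⁻¹) ^ β = (2 : ℝ) ^ (d * σ / α * w * β) := by
    intro w β
    rw [ht, ← Real.rpow_natCast, ← Real.rpow_mul (by norm_num), ← Real.rpow_neg (by norm_num),
      ← Real.rpow_mul (by norm_num)]
    congr 1; ring
  have h2pow : ∀ n : ℕ, (2 : ℝ) ^ (d * n) = (2 : ℝ) ^ ((d : ℝ) * n) := by
    intro n
    rw [← Real.rpow_natCast]; push_cast; rfl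
  obtain ⟨c, f, hc0, hc1, h1, h2⟩ := exists_coding d hd S t ht0 ht2
  refine ⟨Set.range f, Set.range_nonempty f, coding_compact ht0 ht1 h1, ?_,
    microset_of_gap _ (coding_gap ht0 ht1 hc0 hc1 h1 h2 hS2)⟩
  have hup : ∀ β, α < β → β ∈ {α : ℝ | 0 < α ∧ ∃ C : ℝ, 0 < C ∧ ∀ r R : ℝ, 0 < r → r ≤ R → R < 1 →
      ∀ x ∈ Set.range f,
      (coverNum r (closedBall x R ∩ Set.range f) : ℝ≥0∞) ≤ ENNReal.ofReal (C * (R / r) ^ α)} := by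
    intro β hβ
    have hβ0 : 0 < β := hα0.trans hβ
    refine ⟨hβ0, ?_⟩
    obtain ⟨C, hC⟩ := hσ3 (σ * (β - α) / α) (by
      have : 0 < β - α := by linarith
      positivity)
    refine coding_upper ht0 ht1 hc0 hc1 h1 h2 β ((2 : ℝ) ^ (d * C)) hβ0 (by positivity) ?_
    intro m w
    rw [htpow, h2pow, ← Real.rpow_add (by norm_num)]
    refine Real.rpow_le_rpow_of_exponent_le (by norm_num) ?_
    calc (d : ℝ) * cnt S m (m + w) ≤ d * ((σ + σ * (β - α) / α) * w + C) := by
          gcongr; exact hC m w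
      _ = _ := by field_simp; ring
  have hlow : ∀ β ∈ {α : ℝ | 0 < α ∧ ∃ C : ℝ, 0 < C ∧ ∀ r R : ℝ, 0 < r → r ≤ R → R < 1 →
      ∀ x ∈ Set.range f,
      (coverNum r (closedBall x R ∩ Set.range f) : ℝ≥0∞) ≤ ENNReal.ofReal (C * (R / r) ^ α)},
      α ≤ β := by
    rintro β ⟨-, C, hC, h⟩
    by_contra hcon
    refine coding_lower ht0 ht1 hc0 hc1 h1 h2 α β (not_le.1 hcon) ?_ C hC h
    intro w
    obtain ⟨m, hm⟩ := hσ2 w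
    refine ⟨m, ?_⟩
    rw [htpow, h2pow]
    refine Real.rpow_le_rpow_of_exponent_le (by norm_num) ?_
    calc (d : ℝ) * σ / α * w * α = d * (σ * w) := by field_simp
      _ ≤ _ := by gcongr
  unfold assouadDim
  refine le_antisymm ?_ (le_csInf ⟨α + 1, hup _ (by linarith)⟩ hlow)
  refine le_of_forall_gt_imp_ge_of_dense (fun β hβ => csInf_le ⟨α, hlow⟩ (hup β hβ))
end

section
/- Let K ⊂ ℝ^d be compact with dim_A K = d. Then K has a microset with nonempty interior (relative to B(0,1)). -/
open Metric Filter
open scoped ENNReal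

/-- Uniform porosity of a set with constant `ε`. -/
def Por18 {d : ℕ} (K : Set (EuclideanSpace ℝ (Fin d))) (ε : ℝ) : Prop :=
  ∀ x ∈ K, ∀ R : ℝ, 0 < R → R ≤ 1 → ∃ y ∈ closedBall x R, ∀ z ∈ K, z ∈ closedBall x R →
    ε * R < dist z y

/-- Index of the grid box of side `δ` containing a point. -/
noncomputable def idx18 {d : ℕ} (δ : ℝ) (x : EuclideanSpace ℝ (Fin d)) : Fin d → ℤ :=
  fun i => ⌊x i / δ⌋

lemma dist_le_of_coord18 {d : ℕ} (x y : EuclideanSpace ℝ (Fin d)) (δ : ℝ)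
    (h : ∀ i, |x i - y i| ≤ δ) : dist x y ≤ d * δ := by
  rcases Nat.eq_zero_or_pos d with rfl | hd
  · have : x = y := Subsingleton.elim _ _
    simp [this]
  have hδ : 0 ≤ δ := (abs_nonneg _).trans (h ⟨0, hd⟩)
  rw [EuclideanSpace.dist_eq]
  apply Real.sqrt_le_iff.2
  refine ⟨by positivity, ?_⟩
  have h1 : ∑ i : Fin d, dist (x i) (y i) ^ 2 ≤ ∑ i : Fin d, δ ^ 2 := by
    apply Finset.sum_le_sum
    intro i _
    rw [Real.dist_eq]
    exact pow_le_pow_left₀ (abs_nonneg _) (h i) 2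
  have h2 : (1 : ℝ) ≤ d := by exact_mod_cast hd
  simp at h1
  have h3 : (d : ℝ) * δ ^ 2 ≤ (d * δ) ^ 2 := by
    have : 0 ≤ δ ^ 2 := sq_nonneg _
    nlinarith [mul_le_mul_of_nonneg_right h2 (by positivity : 0 ≤ (d : ℝ) * δ ^ 2)]
  linarith

lemma coord_le_dist18 {d : ℕ} (x y : EuclideanSpace ℝ (Fin d)) (i : Fin d) :
    |x i - y i| ≤ dist x y := by
  have := PiLp.norm_apply_le (x - y) i
  simpa [dist_eq_norm] using this

lemma coord_of_idx18 {d : ℕ} {δ : ℝ} (hδ : 0 < δ) {x y : EuclideanSpace ℝ (Fin d)}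
    (h : idx18 δ x = idx18 δ y) (i : Fin d) : |x i - y i| ≤ δ := by
  have h1 : ⌊x i / δ⌋ = ⌊y i / δ⌋ := congrFun h i
  have h2 := Int.abs_sub_lt_one_of_floor_eq_floor h1
  rw [← sub_div, abs_div, abs_of_pos hδ, div_lt_one hδ] at h2
  exact h2.le

lemma idx_div18 {d : ℕ} {δ : ℝ} (hδ : 0 < δ) (M : ℕ) (hM : 0 < M)
    (x : EuclideanSpace ℝ (Fin d)) (i : Fin d) :
    idx18 (δ / M) x i / (M : ℤ) = idx18 δ x i := by
  unfold idx18
  have hM' : (0 : ℝ) < M := by exact_mod_cast hM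
  have h : x i / δ = (x i / (δ / M)) / (M : ℝ) := by field_simp
  rw [h]
  symm
  rw [Int.floor_eq_iff]
  set t := x i / (δ / M)
  have hMz : (0 : ℤ) < M := by exact_mod_cast hM
  have e1 : ⌊t⌋ / (M : ℤ) * M ≤ ⌊t⌋ := Int.ediv_mul_le _ hMz.ne'
  have e2 : ⌊t⌋ + 1 ≤ (⌊t⌋ / (M : ℤ) + 1) * M := by
    have := Int.lt_ediv_add_one_mul_self ⌊t⌋ hMz
    omega
  have e1' : ((⌊t⌋ / (M : ℤ) : ℤ) : ℝ) * M ≤ ⌊t⌋ := by exact_mod_cast e1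
  have e2' : (⌊t⌋ : ℝ) + 1 ≤ (((⌊t⌋ / (M : ℤ) : ℤ) : ℝ) + 1) * M := by exact_mod_cast e2
  constructor
  · rw [le_div_iff₀ hM']; exact e1'.trans (Int.floor_le t)
  · rw [div_lt_iff₀ hM']; exact (Int.lt_floor_add_one t).trans_le e2'

lemma hole18 {d : ℕ} {K : Set (EuclideanSpace ℝ (Fin d))} {ε : ℝ} (hε : 0 < ε) (hε1 : ε ≤ 1)
    (hP : Por18 K ε) {δ : ℝ} (hδ : 0 < δ) (hδ1 : δ ≤ 1) (p : EuclideanSpace ℝ (Fin d)) :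
    ∃ q, dist q p ≤ 3 * δ / 8 ∧ ∀ z ∈ K, ε * δ / 8 < dist z q := by
  by_cases hx : ∃ x ∈ K, dist x p ≤ δ / 8
  · obtain ⟨x, hxK, hxp⟩ := hx
    obtain ⟨y, hy, hyz⟩ := hP x hxK (δ / 4) (by linarith) (by linarith)
    rw [mem_closedBall] at hy
    have hq1 : dist (y + (ε / 2) • (x - y)) x = (1 - ε / 2) * dist y x := by
      have : y + (ε / 2) • (x - y) - x = (1 - ε / 2) • (y - x) := by module
      rw [dist_eq_norm, this, norm_smul, dist_eq_norm, Real.norm_of_nonneg (by linarith)]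
    have hq2 : dist (y + (ε / 2) • (x - y)) y = (ε / 2) * dist y x := by
      rw [dist_eq_norm, add_sub_cancel_left, norm_smul, dist_comm, dist_eq_norm,
        Real.norm_of_nonneg (by linarith)]
    set q := y + (ε / 2) • (x - y)
    have hq1' : dist q x ≤ (1 - ε / 2) * (δ / 4) := by
      rw [hq1]; exact mul_le_mul_of_nonneg_left hy (by linarith)
    have hq2' : dist q y ≤ (ε / 2) * (δ / 4) := by
      rw [hq2]; exact mul_le_mul_of_nonneg_left hy (by linarith)
    have hpos : 0 < ε * δ := by positivity
    refine ⟨q, ?_, ?_⟩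
    · have := dist_triangle q x p
      nlinarith
    · intro z hz
      by_contra hcon
      push Not at hcon
      have t1 := dist_triangle z q x
      have t2 := dist_triangle z q y
      have := hyz z hz (by rw [mem_closedBall]; nlinarith)
      nlinarith
  · push Not at hx
    refine ⟨p, by simp; positivity, fun z hz => ?_⟩
    have := hx z hz
    nlinarith

lemma missing18 {d : ℕ} {K : Set (EuclideanSpace ℝ (Fin d))} {ε : ℝ} (hε : 0 < ε) (hε1 : ε ≤ 1)
    (hP : Por18 K ε) :
    ∃ M : ℕ, 3 ≤ M ∧ ∀ δ : ℝ, 0 < δ → δ ≤ 1 → ∀ a : Fin d → ℤ, ∃ b : Fin d → ℤ,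
      (∀ i, b i / (M : ℤ) = a i) ∧ ∀ x ∈ K, idx18 (δ / M) x ≠ b := by
  obtain ⟨N, hN⟩ := exists_nat_gt (8 * d / ε)
  refine ⟨N + 3, by omega, ?_⟩
  intro δ hδ hδ1 a
  have hMpos : (0 : ℝ) < ((N + 3 : ℕ) : ℝ) := by positivity
  have hMN : 8 * d / ε < ((N + 3 : ℕ) : ℝ) := by push_cast; linarith
  generalize hM : N + 3 = M at *
  obtain ⟨q, hq, hqz⟩ := hole18 hε hε1 hP hδ hδ1
    (WithLp.toLp 2 (fun i => ((a i : ℝ) + 1 / 2) * δ))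
  refine ⟨idx18 (δ / M) q, ?_, ?_⟩
  · intro i
    rw [idx_div18 hδ M (by omega)]
    have h1 := (coord_le_dist18 q _ i).trans hq
    simp only [] at h1
    rw [abs_le] at h1
    unfold idx18
    rw [Int.floor_eq_iff]
    constructor
    · rw [le_div_iff₀ hδ]; nlinarith [h1.1]
    · rw [div_lt_iff₀ hδ]; nlinarith [h1.2]
  · intro x hx hcon
    have h1 := dist_le_of_coord18 x q _ (coord_of_idx18 (by positivity) hcon)
    have h2 := hqz x hx
    rw [div_lt_iff₀ hε] at hMN
    have h3 : (d : ℝ) * (δ / M) ≤ ε * δ / 8 := by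
      rw [← mul_div_assoc, div_le_div_iff₀ hMpos (by norm_num)]
      nlinarith
    linarith

lemma fiber18 {d : ℕ} (M : ℕ) (hM : 0 < M) (a b : Fin d → ℤ) (hb : ∀ i, b i / (M : ℤ) = a i) :
    ∃ F : Finset (Fin d → ℤ), F.card ≤ M ^ d - 1 ∧
      ∀ c : Fin d → ℤ, (∀ i, c i / (M : ℤ) = a i) → c ≠ b → c ∈ F := by
  classical
  have hMz : (0 : ℤ) < M := by exact_mod_cast hM
  have key : ∀ c : Fin d → ℤ, (∀ i, c i / (M : ℤ) = a i) →
      c ∈ Fintype.piFinset (fun i => Finset.Ico (a i * M) (a i * M + M)) := by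
    intro c hc
    rw [Fintype.mem_piFinset]
    intro i
    rw [Finset.mem_Ico, ← hc i]
    have := Int.ediv_mul_le (c i) hMz.ne'
    have h2 := Int.lt_ediv_add_one_mul_self (c i) hMz
    constructor
    · exact this
    · linarith
  refine ⟨(Fintype.piFinset (fun i => Finset.Ico (a i * M) (a i * M + M))).erase b, ?_, ?_⟩
  · rw [Finset.card_erase_of_mem (key b hb), Fintype.card_piFinset]
    simp
  · intro c hc hcb
    exact Finset.mem_erase.2 ⟨hcb, key c hc⟩

lemma count18 {d : ℕ} {K : Set (EuclideanSpace ℝ (Fin d))} {M : ℕ} (hM : 3 ≤ M)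
    (hmiss : ∀ δ : ℝ, 0 < δ → δ ≤ 1 → ∀ a : Fin d → ℤ, ∃ b : Fin d → ℤ,
      (∀ i, b i / (M : ℤ) = a i) ∧ ∀ x ∈ K, idx18 (δ / M) x ≠ b)
    (x : EuclideanSpace ℝ (Fin d)) (R : ℝ) (hR : 0 < R) (hR1 : R ≤ 1) (k : ℕ) :
    ∃ F : Finset (Fin d → ℤ), F.card ≤ 3 ^ d * (M ^ d - 1) ^ k ∧
      ∀ z ∈ closedBall x R ∩ K, idx18 (R / M ^ k) z ∈ F := by
  classical
  have hM1 : (1 : ℝ) ≤ M := by exact_mod_cast (by omega : 1 ≤ M)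
  induction k with
  | zero =>
    refine ⟨Fintype.piFinset (fun i => Finset.Icc (⌊x i / R⌋ - 1) (⌊x i / R⌋ + 1)), ?_, ?_⟩
    · rw [Fintype.card_piFinset]
      simp
      have : ∀ i, (⌊x i / R⌋ + 1 + 1 - (⌊x i / R⌋ - 1)).toNat = 3 := by intro i; omega
      simp [this]
    · intro z hz
      rw [Fintype.mem_piFinset]
      intro i
      have h1 := (coord_le_dist18 z x i).trans hz.1
      rw [abs_le] at h1
      simp only [idx18, pow_zero, div_one, Finset.mem_Icc]
      have e1 : x i / R - 1 ≤ z i / R := by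
        rw [div_sub_one hR.ne']; gcongr; linarith
      have e2 : z i / R ≤ x i / R + 1 := by
        rw [div_add_one hR.ne']; gcongr; linarith
      constructor
      · rw [← Int.floor_sub_one]; exact Int.floor_le_floor e1
      · rw [← Int.floor_add_one]; exact Int.floor_le_floor e2
  | succ k ih =>
    obtain ⟨F, hF, hFz⟩ := ih
    have hMk : (1 : ℝ) ≤ (M : ℝ) ^ k := one_le_pow₀ hM1
    have hδ : 0 < R / (M : ℝ) ^ k := by positivity
    have hδ1 : R / (M : ℝ) ^ k ≤ 1 := by
      rw [div_le_one (by positivity)]; linarith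
    choose b hb hbK using hmiss _ hδ hδ1
    choose G hG hGm using fun a => fiber18 M (by omega) a (b a) (hb a)
    refine ⟨F.biUnion G, ?_, ?_⟩
    · calc (F.biUnion G).card ≤ F.card * (M ^ d - 1) :=
            Finset.card_biUnion_le_card_mul _ _ _ (fun a _ => hG a)
        _ ≤ (3 ^ d * (M ^ d - 1) ^ k) * (M ^ d - 1) := Nat.mul_le_mul_right _ hF
        _ = _ := by ring
    · intro z hz
      rw [Finset.mem_biUnion]
      refine ⟨_, hFz z hz, ?_⟩
      have e : R / (M : ℝ) ^ (k + 1) = R / (M : ℝ) ^ k / M := by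
        rw [pow_succ, div_div]
      rw [e]
      exact hGm _ _ (fun i => idx_div18 hδ M (by omega) z i) (hbK _ z hz.2)

lemma cover18 {d : ℕ} (A : Set (EuclideanSpace ℝ (Fin d))) (δ r : ℝ) (hδ : 0 < δ)
    (hr : d * δ ≤ r) (F : Finset (Fin d → ℤ)) (hF : ∀ z ∈ A, idx18 δ z ∈ F) :
    coverNum r A ≤ (F.card : ℕ∞) := by
  classical
  have hfin : (idx18 δ '' A).Finite := F.finite_toSet.subset (by
    rintro _ ⟨z, hz, rfl⟩; exact hF z hz)
  obtain ⟨S, hSA, hS⟩ : ∃ S : Set (EuclideanSpace ℝ (Fin d)), S ⊆ A ∧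
      Set.BijOn (idx18 δ) S (idx18 δ '' A) := (Set.surjOn_image _ _).exists_bijOn_subset
  have hSf : S.Finite := hS.finite_iff_finite.2 hfin
  have h1 : coverNum r A ≤ (hSf.toFinset.card : ℕ∞) := by
    apply sInf_le
    refine ⟨hSf.toFinset, ⟨by simpa using hSA, ?_⟩, rfl⟩
    intro z hz
    obtain ⟨s, hs, hsz⟩ := hS.surjOn ⟨z, hz, rfl⟩
    simp only [Set.mem_iUnion]
    refine ⟨s, by simpa using hs, ?_⟩
    rw [mem_closedBall]
    exact (dist_le_of_coord18 z s δ (coord_of_idx18 hδ hsz.symm)).trans hr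
  refine h1.trans ?_
  have : hSf.toFinset.card ≤ F.card := by
    apply Finset.card_le_card_of_injOn (idx18 δ)
    · intro s hs
      exact hF s (hSA (by simpa using hs))
    · simpa using hS.injOn
  exact_mod_cast this

lemma por_false18 {d : ℕ} {K : Set (EuclideanSpace ℝ (Fin d))} (hne : K.Nonempty)
    (hdim : assouadDim K = d) {ε : ℝ} (hε : 0 < ε) (hε1 : ε ≤ 1) (hP : Por18 K ε) : False := by
  rcases Nat.eq_zero_or_pos d with rfl | hd
  · obtain ⟨x, hx⟩ := hne
    obtain ⟨y, hy, h⟩ := hP x hx 1 one_pos le_rfl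
    have := h x hx (by simp)
    have hxy : x = y := Subsingleton.elim _ _
    rw [hxy] at this
    simp at this
    linarith
  obtain ⟨M, hM, hmiss⟩ := missing18 hε hε1 hP
  have hMr : (3 : ℝ) ≤ M := by exact_mod_cast hM
  have hd1 : (1 : ℝ) ≤ d := by exact_mod_cast hd
  have hMd : (3 : ℝ) ≤ (M : ℝ) ^ d := hMr.trans (le_self_pow₀ (by linarith) hd.ne')
  set α := Real.logb M ((M : ℝ) ^ d - 1) with hα
  have hα0 : 0 < α := Real.logb_pos (by linarith) (by linarith)
  have hMα : (M : ℝ) ^ α = (M : ℝ) ^ d - 1 :=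
    Real.rpow_logb (by linarith) (by linarith) (by linarith)
  have hαd : α < d := by
    rw [hα, Real.logb_lt_iff_lt_rpow (by linarith) (by linarith), Real.rpow_natCast]
    linarith
  have hle : assouadDim K ≤ α := by
    apply csInf_le ⟨0, fun a ha => ha.1.le⟩
    refine ⟨hα0, 3 ^ d * ((M : ℝ) * d) ^ α, by positivity, ?_⟩
    intro r R hr hrR hR1 x hx
    have hR : 0 < R := hr.trans_le hrR
    have hRr : 1 ≤ R / r := by rwa [one_le_div hr]
    obtain ⟨k, hk1, hk2⟩ : ∃ k : ℕ, d * (R / r) ≤ (M : ℝ) ^ k ∧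
        (M : ℝ) ^ k ≤ M * d * (R / r) := by
      have hex : ∃ k : ℕ, d * (R / r) ≤ (M : ℝ) ^ k := by
        obtain ⟨k, hk⟩ := pow_unbounded_of_one_lt (d * (R / r)) (by linarith : (1 : ℝ) < M)
        exact ⟨k, hk.le⟩
      classical
      refine ⟨Nat.find hex, Nat.find_spec hex, ?_⟩
      rcases hk : Nat.find hex with _ | k
      · rw [pow_zero]
        have : 1 ≤ (M : ℝ) * d := by nlinarith
        nlinarith
      · have := Nat.find_min hex (m := k) (by omega)
        push Not at this
        rw [pow_succ]
        nlinarith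
    obtain ⟨F, hF, hFz⟩ := count18 hM hmiss x R hR hR1.le k
    have hMk : 0 < (M : ℝ) ^ k := by positivity
    have hcov := cover18 _ (R / (M : ℝ) ^ k) r (by positivity) (by
      rw [← mul_div_assoc, div_le_iff₀ hMk]
      rw [← mul_div_assoc, div_le_iff₀ hr] at hk1
      linarith) F hFz
    have h1 : (coverNum r (closedBall x R ∩ K) : ℝ≥0∞) ≤ (F.card : ℝ≥0∞) := by
      have := ENat.toENNReal_le.2 hcov
      simpa using this
    refine h1.trans ?_
    rw [← ENNReal.ofReal_natCast]
    apply ENNReal.ofReal_le_ofReal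
    have h2 : (F.card : ℝ) ≤ 3 ^ d * ((M : ℝ) ^ d - 1) ^ k := by
      have h3 : (F.card : ℝ) ≤ ((3 ^ d * (M ^ d - 1) ^ k : ℕ) : ℝ) := by exact_mod_cast hF
      have h4 : 1 ≤ M ^ d := Nat.one_le_pow _ _ (by omega)
      push_cast [Nat.cast_sub h4] at h3
      exact h3
    refine h2.trans ?_
    rw [mul_assoc, ← Real.mul_rpow (by positivity) (by positivity), ← hMα]
    apply mul_le_mul_of_nonneg_left _ (by positivity)
    rw [← Real.rpow_natCast, ← Real.rpow_mul (by positivity), mul_comm α,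
      Real.rpow_mul (by positivity), Real.rpow_natCast]
    exact Real.rpow_le_rpow (by positivity) hk2 hα0.le
  rw [hdim] at hle
  linarith

/-- a compact set `K ⊆ ℝᵈ` of Assouad dimension `d` has a microset with
nonempty interior relative to the closed unit ball. -/
theorem statement18 {d : ℕ} (K : Set (EuclideanSpace ℝ (Fin d)))
    (hne : K.Nonempty) (hK : IsCompact K) (hdim : assouadDim K = d) :
    ∃ E : Set (EuclideanSpace ℝ (Fin d)), IsMicroset K E ∧
      ∃ U : Set (EuclideanSpace ℝ (Fin d)), IsOpen U ∧
        (U ∩ closedBall 0 1).Nonempty ∧ U ∩ closedBall 0 1 ⊆ E := by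
  refine ⟨closedBall 0 1, ⟨⟨0, by simp⟩, isCompact_closedBall _ _, ?_⟩,
    Set.univ, isOpen_univ, ⟨0, by simp⟩, by simp⟩
  have hnp : ∀ n : ℕ, ∃ x ∈ K, ∃ R : ℝ, 0 < R ∧ R ≤ 1 ∧ ∀ y ∈ closedBall x R,
      ∃ z ∈ K, z ∈ closedBall x R ∧ dist z y ≤ 1 / ((n : ℝ) + 1) * R := by
    intro n
    by_contra hcon
    refine por_false18 hne hdim (ε := 1 / ((n : ℝ) + 1)) (by positivity) ?_ ?_
    · rw [div_le_one (by positivity)]; linarith [(Nat.cast_nonneg n : (0 : ℝ) ≤ n)]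
    · intro x hx R hR hR1
      by_contra h2
      push Not at h2
      exact hcon ⟨x, hx, R, hR, hR1, h2⟩
  choose x hx R hR hR1 hd using hnp
  have h0 : ∀ n, (miniset K (x n) (R n)⁻¹).Nonempty := fun n =>
    ⟨0, ⟨x n, hx n, by simp⟩, by simp⟩
  refine ⟨x, fun n => (R n)⁻¹, hx, fun n => (one_le_inv₀ (hR n)).2 (hR1 n), h0, ?_⟩
  refine squeeze_zero (fun _ => hausdorffDist_nonneg) (fun n => ?_)
    tendsto_one_div_add_atTop_nhds_zero_nat
  have hRn := hR n
  apply hausdorffDist_le_of_mem_dist (by positivity)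
  · intro y hy
    exact ⟨y, hy.2, by simp; positivity⟩
  · intro y hy
    rw [mem_closedBall_zero_iff] at hy
    obtain ⟨z, hz, hzx, hzy⟩ := hd n (x n + R n • y) (by
      rw [mem_closedBall, dist_eq_norm, add_sub_cancel_left, norm_smul,
        Real.norm_of_nonneg hRn.le]
      nlinarith)
    refine ⟨(R n)⁻¹ • (z - x n), ⟨⟨z, hz, rfl⟩, ?_⟩, ?_⟩
    · rw [mem_closedBall_zero_iff, norm_smul, norm_inv, Real.norm_of_nonneg hRn.le,
        inv_mul_le_iff₀ hRn, mul_one, ← dist_eq_norm]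
      exact hzx
    · have e : (R n)⁻¹ • (z - x n) - y = (R n)⁻¹ • (z - (x n + R n • y)) := by
        rw [← sub_sub, smul_sub (R n)⁻¹ (z - x n), smul_smul, inv_mul_cancel₀ hRn.ne', one_smul]
      rw [dist_comm, dist_eq_norm, e, norm_smul, norm_inv, Real.norm_of_nonneg hRn.le,
        inv_mul_le_iff₀ hRn, ← dist_eq_norm, mul_comm]
      exact hzy
end
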